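/- There exists an absolute constant β₀ such that for β > β₀ and 0 < λ ≤ 1: for each integer h ≥ 0 the truncated free energy f^tr_h = lim_{n→∞} |Λ_n|^{−1} log Z^tr_{η,h,Λ_n} exists (and is independent of the boundary signing η); moreover, for every finite, not necessarily simply-connected, U ⊂ ℤ², every h ≥ 0 and every boundary signing η, |log Z^tr_{η,h,U} − |U| · f^tr_h| ≤ e^{−β/2}|∂_e U|. -/

import Mathlib

open scoped BigOperators
open Filter

noncomputable section

attribute [local instance] Classical.propDecidable

/-! ### Basic geometry of the square lattice -/

/-- Sites of the square lattice `ℤ²`. -/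
abbrev Site := ℤ × ℤ

/-- The four unit directions. -/
def dirs : Finset Site := {(1, 0), (-1, 0), (0, 1), (0, -1)}

/-- The box `Λ_n = ⟦-n/2, n/2⟧² ∩ ℤ²`. -/
def box (n : ℕ) : Finset Site :=
  Finset.Icc (-((n : ℤ) / 2)) ((n : ℤ) / 2) ×ˢ Finset.Icc (-((n : ℤ) / 2)) ((n : ℤ) / 2)

/-- SOS gradient energy of a height function on a domain `V`: each nearest-neighbour
edge with at least one endpoint in `V` contributes the absolute height gradient
(the directed sum below counts internal edges twice, whence the factor `1/2`). -/
def sosEnergy (V : Finset Site) (ψ : Site → ℤ) : ℝ :=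
  ∑ v ∈ V, ∑ d ∈ dirs,
    (if v + d ∈ V then (1 : ℝ) / 2 else 1) * |(ψ v : ℝ) - (ψ (v + d) : ℝ)|

/-- The bulk field term `Σ_{v ∈ V} ψ_v`. -/
def sosField (V : Finset Site) (ψ : Site → ℤ) : ℝ := ∑ v ∈ V, (ψ v : ℝ)

/-- The SOS weight `exp(-β Σ|∇ψ| - λ Σ ψ)`. -/
def sosWt (β lam : ℝ) (V : Finset Site) (ψ : Site → ℤ) : ℝ :=
  Real.exp (-(β * sosEnergy V ψ + lam * sosField V ψ))

/-- The inner boundary `∂_i V`. -/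
def innerBdry (V : Finset Site) : Finset Site :=
  V.filter fun v => ∃ d ∈ dirs, v + d ∉ V

/-- The interior `V̊ = V ∖ ∂_i V`. -/
def interiorSites (V : Finset Site) : Finset Site := V \ innerBdry V

/-- The number of edges `|∂_e V|` between `V` and its complement. -/
def edgeBdryCard (V : Finset Site) : ℕ :=
  ∑ v ∈ V, (dirs.filter fun d => v + d ∉ V).card

/-- Nearest-neighbour adjacency. -/
def adjS (u v : Site) : Prop := v - u ∈ dirs

/-- A set of sites is connected (as a subgraph of `ℤ²`). -/
def connectedIn (S : Set Site) : Prop :=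
  ∀ x ∈ S, ∀ y ∈ S,
    Relation.ReflTransGen (fun a b => adjS a b ∧ a ∈ S ∧ b ∈ S) x y

/-- A finite set of sites is simply connected: it is connected and its complement is
connected. -/
def SimplyConn (V : Finset Site) : Prop :=
  connectedIn (↑V : Set Site) ∧ connectedIn ((↑V : Set Site)ᶜ)

/-! ### SOS measures with a boundary signing -/

/-- A boundary signing value: `+`, `-`, `∅` or free. -/
inductive BSign | plus | minus | zero | free

/-- The constraint imposed at an inner-boundary site by a signing, for boundary height
`h`: `+` forces `≥ h`, `-` forces `≤ h`, `∅` forces `= h`, and `f` forces nothing. -/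
def BSign.ok : BSign → ℤ → ℤ → Prop
  | .plus, h, t => h ≤ t
  | .minus, h, t => t ≤ h
  | .zero, h, t => t = h
  | .free, _, _ => True

/-- Height functions with boundary condition identically `h` outside `V`, floor `0`
on `V` (and no ceiling), compatible with the boundary signing `η` along `∂_i V`. -/
def signedConfigs (V : Finset Site) (η : Site → BSign) (h : ℤ) : Set (Site → ℤ) :=
  {ψ | (∀ x, x ∉ V → ψ x = h) ∧ (∀ v ∈ V, 0 ≤ ψ v) ∧
       ∀ v ∈ innerBdry V, BSign.ok (η v) h (ψ v)}

/-- The partition function `Z_{η,h,V}`. -/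
def Zsos (β lam : ℝ) (η : Site → BSign) (h : ℤ) (V : Finset Site) : ℝ :=
  ∑' ψ : Site → ℤ, Set.indicator (signedConfigs V η h) (sosWt β lam V) ψ

/-- Probability of an event under the SOS measure `μ_{η,h,V}`. -/
def Psos (β lam : ℝ) (η : Site → BSign) (h : ℤ) (V : Finset Site)
    (E : Set (Site → ℤ)) : ℝ :=
  (∑' ψ : Site → ℤ, Set.indicator (signedConfigs V η h ∩ E) (sosWt β lam V) ψ) /
    Zsos β lam η h V

/-! ### Contours -/

/-- A (signed geometric) contour, encoded by the finite set of sites it encloses and its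
sign (up/down); the contour itself is the dual circuit `(∂_e Int)^*`. -/
structure Contour where
  int : Finset Site
  up : Bool

/-- The length `|γ|` of a contour: the number of boundary edges of its interior. -/
def Contour.len (γ : Contour) : ℕ := edgeBdryCard γ.int

/-- A valid contour encloses a nonempty simply-connected set of sites. -/
def Contour.valid (γ : Contour) : Prop :=
  γ.int.Nonempty ∧ connectedIn (↑γ.int : Set Site) ∧ connectedIn ((↑γ.int : Set Site)ᶜ)

/-- The constant boundary signing. -/
def constSign (s : BSign) : Site → BSign := fun _ => s

/-- The `h`-renormalized weight `W^rn_h(γ)`. -/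
def Wrn (β lam : ℝ) (h : ℤ) (γ : Contour) : ℝ :=
  if γ.up then
    Real.exp (-β * (γ.len : ℝ)) *
      (Zsos β lam (constSign .plus) (h + 1) γ.int / Zsos β lam (constSign .plus) h γ.int)
  else
    Real.exp (-β * (γ.len : ℝ)) *
      (Zsos β lam (constSign .minus) (h - 1) γ.int / Zsos β lam (constSign .minus) h γ.int)

/-- The `h`-truncated weight `W^tr_h(γ) = min{W^rn_h(γ), e^{-(β-5)|γ|}}`. -/
def Wtr (β lam : ℝ) (h : ℤ) (γ : Contour) : ℝ :=
  min (Wrn β lam h γ) (Real.exp (-(β - 5) * (γ.len : ℝ)))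

/-- The elementary diameter bound `min{λ⁻¹, e^{3β(h+1)}}`. -/
def elemBound (β lam : ℝ) (h : ℤ) : ℝ := min (1 / lam) (Real.exp (3 * β * ((h : ℝ) + 1)))

/-- A set of sites is `h`-elementary small: the enclosing contour (whose ℓ∞-diameter is
one more than that of the enclosed set) has diameter at most `min{λ⁻¹, e^{3β(h+1)}}`. -/
def elemSet (β lam : ℝ) (h : ℤ) (S : Set Site) : Prop :=
  ∀ x ∈ S, ∀ y ∈ S,
    ((max |x.1 - y.1| |x.2 - y.2| : ℤ) : ℝ) + 1 ≤ elemBound β lam h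

/-- A contour is `h`-elementary if `diam(γ) ≤ min{λ⁻¹, e^{3β(h+1)}}`. -/
def IsElem (β lam : ℝ) (h : ℤ) (γ : Contour) : Prop := elemSet β lam h (↑γ.int : Set Site)

/-- Two finite sets of sites share a (primal, equivalently dual) boundary edge. -/
def shareEdge (A B : Finset Site) : Prop :=
  ∃ v, ∃ d ∈ dirs, (v ∈ A ∧ v + d ∉ A) ∧ ((v ∈ B ∧ v + d ∉ B) ∨ (v + d ∈ B ∧ v ∉ B))

/-- Compatibility of a pair of signed contours: they may not cross, and if they overlap
on an edge their signs agree when nested and differ when mutually external. -/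
def compatPair (γ γ' : Contour) : Prop :=
  (γ.int ⊆ γ'.int ∨ γ'.int ⊆ γ.int ∨ Disjoint γ.int γ'.int) ∧
  (shareEdge γ.int γ'.int →
    ((γ.int ⊆ γ'.int ∨ γ'.int ⊆ γ.int) → γ.up = γ'.up) ∧
    (Disjoint γ.int γ'.int → γ.up ≠ γ'.up))

/-- Admissible renormalized families of signed contours in `U`, compatible with the
boundary signing `η` at reference height `h` (no floor constraint except that no
down-contours are allowed when `h = 0`). -/
def famOK (η : Site → BSign) (h : ℤ) (U : Finset Site) (Γ : Multiset Contour) : Prop :=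
  (∀ γ ∈ Γ, Contour.valid γ ∧ γ.int ⊆ U) ∧
  (∀ γ ∈ Γ, ∀ γ' ∈ Γ, compatPair γ γ') ∧
  (∀ v ∈ innerBdry U, ∀ γ ∈ Γ, v ∈ γ.int →
    (γ.up = true → η v ≠ BSign.minus ∧ η v ≠ BSign.zero) ∧
    (γ.up = false → η v ≠ BSign.plus ∧ η v ≠ BSign.zero)) ∧
  (h = 0 → ∀ γ ∈ Γ, γ.up = true)

/-- The product of weights of a family of contours. -/
def prodW (w : Contour → ℝ) (Γ : Multiset Contour) : ℝ := (Γ.map w).prod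

/-- The truncated partition function `Z^tr_{η,h,U}`. -/
def Ztr (β lam : ℝ) (η : Site → BSign) (h : ℤ) (U : Finset Site) : ℝ :=
  Real.exp (-lam * (h : ℝ) * (U.card : ℝ)) *
    ∑' Γ : Multiset Contour, Set.indicator {Γ | famOK η h U Γ} (prodW (Wtr β lam h)) Γ

/-- The renormalized partition function `Z^rn_{η,h,U}`. -/
def Zrn (β lam : ℝ) (η : Site → BSign) (h : ℤ) (U : Finset Site) : ℝ :=
  Real.exp (-lam * (h : ℝ) * (U.card : ℝ)) *
    ∑' Γ : Multiset Contour, Set.indicator {Γ | famOK η h U Γ} (prodW (Wrn β lam h)) Γ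

/-- The renormalized elementary partition function `Z^{rn.el}_{η,h,U}`. -/
def Zrnel (β lam : ℝ) (η : Site → BSign) (h : ℤ) (U : Finset Site) : ℝ :=
  Real.exp (-lam * (h : ℝ) * (U.card : ℝ)) *
    ∑' Γ : Multiset Contour,
      Set.indicator {Γ | famOK η h U Γ ∧ ∀ γ ∈ Γ, IsElem β lam h γ}
        (prodW (Wrn β lam h)) Γ

/-! ### Elementary restriction of the SOS measure -/

/-- `*`-adjacency (adjacency allowing diagonal steps). -/
def starAdj (u v : Site) : Prop := u ≠ v ∧ |u.1 - v.1| ≤ 1 ∧ |u.2 - v.2| ≤ 1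

/-- The `*`-connected component of `x` within `S`. -/
def compStar (S : Set Site) (x : Site) : Set Site :=
  {y | Relation.ReflTransGen (fun a b => starAdj a b ∧ a ∈ S ∧ b ∈ S) x y}

/-- The fill of a set of sites: the set together with all sites whose
complement-component is finite. -/
def fill (C : Set Site) : Set Site :=
  C ∪ {x | {y | Relation.ReflTransGen (fun a b => adjS a b ∧ a ∉ C ∧ b ∉ C) x y}.Finite}

/-- All outermost contours of the configuration `ψ` (with boundary height `h` on `V`)
are `h`-elementary: every filled deviation component is elementary-small. -/
def allOuterElem (β lam : ℝ) (h : ℤ) (V : Finset Site) (ψ : Site → ℤ) : Prop :=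
  ∀ v ∈ V, ψ v ≠ h → elemSet β lam h (fill (compStar {u : Site | u ∈ V ∧ ψ u ≠ h} v))

/-- The elementary partition function `Z^el_{η,h,V}`: the contribution to `Z_{η,h,V}`
of configurations all of whose outermost contours are `h`-elementary. -/
def Zel (β lam : ℝ) (η : Site → BSign) (h : ℤ) (V : Finset Site) : ℝ :=
  ∑' ψ : Site → ℤ,
    Set.indicator (signedConfigs V η h ∩ {ψ | allOuterElem β lam h V ψ})
      (sosWt β lam V) ψ

/-! ### Truncated free energies and the critical sequence -/

/-- `ftr h` is the truncated free energy `f^tr_h(λ)`: the infinite-volume limit of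
`|Λ_n|⁻¹ log Z^tr_{η,h,Λ_n}`, for every boundary signing. -/
def FTRlimit (β : ℝ) (ftr : ℕ → ℝ → ℝ) : Prop :=
  ∀ h : ℕ, ∀ lam : ℝ, 0 < lam → lam ≤ 1 → ∀ η : Site → BSign,
    Tendsto (fun n => Real.log (Ztr β lam η (h : ℤ) (box n)) / ((box n).card : ℝ))
      atTop (nhds (ftr h lam))

/-- `lamc` is the strictly decreasing sequence `(λ_c^{(k)})_{k≥0}` of critical points,
tending to `0`, at which the truncated free energies `ftr` exchange maximizer. -/
def CritSeq (ftr : ℕ → ℝ → ℝ) (lamc : ℕ → ℝ) : Prop :=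
  StrictAnti lamc ∧ (∀ i, 0 < lamc i) ∧ Tendsto lamc atTop (nhds 0) ∧
  (∀ i : ℕ, ∀ lam : ℝ, 0 < lam → lam ≤ 1 → lamc i < lam →
    (i = 0 ∨ lam < lamc (i - 1)) → ∀ j : ℕ, j ≠ i → ftr j lam < ftr i lam) ∧
  (∀ i : ℕ, ftr (i + 1) (lamc i) = ftr i (lamc i) ∧
    ∀ j : ℕ, j ≠ i → j ≠ i + 1 → ftr j (lamc i) < ftr i (lamc i))

/-- `d(x) = min_k |λ_c^{(k)} - x|`. -/
def dmin (lamc : ℕ → ℝ) (x : ℝ) : ℝ := ⨅ k : ℕ, |lamc k - x|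

/-- `d⁺(x) = min{λ_c^{(k)} - x : λ_c^{(k)} > x}`. -/
def dplus (lamc : ℕ → ℝ) (x : ℝ) : ℝ := sInf {y : ℝ | ∃ k, x < lamc k ∧ y = lamc k - x}

/-! ### SOS measures with general boundary conditions (floor 0, no ceiling) -/

/-- Height functions equal to the boundary condition `φ` off `V` and nonnegative on `V`. -/
def bcConfigs (V : Finset Site) (φ : Site → ℤ) : Set (Site → ℤ) :=
  {ψ | (∀ x, x ∉ V → ψ x = φ x) ∧ ∀ v ∈ V, 0 ≤ ψ v}

/-- The partition function with boundary condition `φ`. -/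
def Zbc (β lam : ℝ) (V : Finset Site) (φ : Site → ℤ) : ℝ :=
  ∑' ψ : Site → ℤ, Set.indicator (bcConfigs V φ) (sosWt β lam V) ψ

/-- Probability of an event under the SOS measure `μ_{φ,V}` (floor 0, no ceiling). -/
def Pbc (β lam : ℝ) (V : Finset Site) (φ : Site → ℤ) (E : Set (Site → ℤ)) : ℝ :=
  (∑' ψ : Site → ℤ, Set.indicator (bcConfigs V φ ∩ E) (sosWt β lam V) ψ) /
    Zbc β lam V φ

/-! ### Glauber dynamics on the box with a ceiling -/

/-- A configuration on `Λ_n` with floor `0` and ceiling `ℓ`. -/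
abbrev Cfg (n ℓ : ℕ) := {x : Site // x ∈ box n} → Fin (ℓ + 1)

/-- Extension of a configuration by the zero boundary condition. -/
def cExt {n ℓ : ℕ} (ψ : Cfg n ℓ) : Site → ℤ :=
  fun x => if h : x ∈ box n then ((ψ ⟨x, h⟩ : ℕ) : ℤ) else 0

/-- The weight of a configuration (zero boundary conditions). -/
def cWt (n ℓ : ℕ) (β lam : ℝ) (ψ : Cfg n ℓ) : ℝ := sosWt β lam (box n) (cExt ψ)

/-- The partition function on `Λ_n` with ceiling `ℓ` and zero boundary conditions. -/
def cZ (n ℓ : ℕ) (β lam : ℝ) : ℝ := ∑ ψ : Cfg n ℓ, cWt n ℓ β lam ψ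

/-- The SOS probability measure `μ_{n,λ}` (ceiling `ℓ`, zero boundary conditions). -/
def cPi (n ℓ : ℕ) (β lam : ℝ) (ψ : Cfg n ℓ) : ℝ := cWt n ℓ β lam ψ / cZ n ℓ β lam

/-- Probability of an event under `μ_{n,λ}`. -/
def cProb (n ℓ : ℕ) (β lam : ℝ) (E : Set (Cfg n ℓ)) : ℝ :=
  (∑ ψ : Cfg n ℓ, if ψ ∈ E then cWt n ℓ β lam ψ else 0) / cZ n ℓ β lam

/-- The Glauber (heat-bath) jump rate from `ψ` to `ψ' ≠ ψ`: nonzero only if they differ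
at a single site `v` by exactly one, in which case `v`'s height is resampled among
`{ψ_v - 1, ψ_v, ψ_v + 1}` (truncated at the floor and the ceiling) according to the
conditional probabilities given the other heights. -/
def glRate (n ℓ : ℕ) (β lam : ℝ) (ψ ψ' : Cfg n ℓ) : ℝ :=
  if ψ = ψ' then 0
  else
    ∑ v : {x : Site // x ∈ box n},
      if (∀ u, u ≠ v → ψ u = ψ' u) ∧ (((ψ' v : ℕ) : ℤ) - ((ψ v : ℕ) : ℤ)) ^ 2 = 1 then
        cWt n ℓ β lam ψ' /
          ∑ t : Fin (ℓ + 1),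
            (if (((t : ℕ) : ℤ) - ((ψ v : ℕ) : ℤ)) ^ 2 ≤ 1 then
              cWt n ℓ β lam (Function.update ψ v t) else 0)
      else 0

/-- Mean of an observable under `μ_{n,λ}`. -/
def cMean (n ℓ : ℕ) (β lam : ℝ) (f : Cfg n ℓ → ℝ) : ℝ :=
  ∑ ψ : Cfg n ℓ, cPi n ℓ β lam ψ * f ψ

/-- Variance of an observable under `μ_{n,λ}`. -/
def cVar (n ℓ : ℕ) (β lam : ℝ) (f : Cfg n ℓ → ℝ) : ℝ :=
  ∑ ψ : Cfg n ℓ, cPi n ℓ β lam ψ * (f ψ - cMean n ℓ β lam f) ^ 2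

/-- The Dirichlet form of the Glauber dynamics. -/
def cDirichlet (n ℓ : ℕ) (β lam : ℝ) (f : Cfg n ℓ → ℝ) : ℝ :=
  (1 / 2) * ∑ ψ : Cfg n ℓ, ∑ ψ' : Cfg n ℓ,
    cPi n ℓ β lam ψ * glRate n ℓ β lam ψ ψ' * (f ψ' - f ψ) ^ 2

/-- The spectral gap `gap_{n,λ}` of the generator of the Glauber dynamics (ceiling `ℓ`):
by reversibility, the smallest nonzero eigenvalue of minus the generator equals the
infimum of the Rayleigh quotients `E(f,f)/Var(f)`. -/
def specGap (n ℓ : ℕ) (β lam : ℝ) : ℝ :=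
  sInf {r : ℝ | ∃ f : Cfg n ℓ → ℝ,
    cVar n ℓ β lam f ≠ 0 ∧ r = cDirichlet n ℓ β lam f / cVar n ℓ β lam f}

end


section PartA
attribute [local instance] Classical.propDecidable

theorem walk_exists {α : Type*} (R : α → α → Prop) (hs : ∀ a b, R a b → R b a)
    (S : Finset α) (e : α) (he : e ∈ S)
    (hconn : ∀ E1 ⊆ S, e ∈ E1 → (∀ a ∈ E1, ∀ b ∈ S, R a b → b ∈ E1) → E1 = S) :
    ∃ l : List α, (e :: l).IsChain R ∧ (e :: l).toFinset = S ∧ l.length + 2 = 2 * S.card := by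
  have key : ∀ n : ℕ, n + 1 ≤ S.card → ∃ l : List α, (e :: l).IsChain R ∧
      (e :: l).toFinset ⊆ S ∧ (e :: l).toFinset.card = n + 1 ∧ l.length = 2 * n := by
    intro n
    induction n with
    | zero =>
      intro _
      exact ⟨[], by simp, by simpa using he, by simp, by simp⟩
    | succ n ih =>
      intro hn
      obtain ⟨l, h1, h2, h3, h4⟩ := ih (by omega)
      have hne : (e :: l).toFinset ≠ S := by
        intro h; rw [h] at h3; omega
      have : ∃ a ∈ (e :: l).toFinset, ∃ b ∈ S, R a b ∧ b ∉ (e :: l).toFinset := by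
        by_contra hcon
        push Not at hcon
        exact hne (hconn _ h2 (by simp) hcon)
      obtain ⟨a, ha, b, hb, hab, hbn⟩ := this
      obtain ⟨s, t, hst⟩ := List.append_of_mem (List.mem_toFinset.1 ha)
      have hch : (s ++ a :: b :: a :: t).IsChain R := by
        rw [hst] at h1
        rw [List.isChain_split] at h1 ⊢
        refine ⟨h1.1, ?_⟩
        rw [List.isChain_cons_cons, List.isChain_cons_cons]
        exact ⟨hab, hs _ _ hab, h1.2⟩
      have hfs : (s ++ a :: b :: a :: t).toFinset = insert b (e :: l).toFinset := by
        rw [hst]; ext z; simp only [List.mem_toFinset, List.mem_append, List.mem_cons, Finset.mem_insert]; tauto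
      have hlen : (s ++ a :: b :: a :: t).length = (e :: l).length + 2 := by
        rw [hst]; simp only [List.length_append, List.length_cons]; omega
      have hhd : ∃ l', s ++ a :: b :: a :: t = e :: l' := by
        cases s with
        | nil => simp at hst; exact ⟨b :: a :: t, by simp [hst.1]⟩
        | cons c s => simp at hst; exact ⟨s ++ a :: b :: a :: t, by simp [hst.1]⟩
      obtain ⟨l', hl'⟩ := hhd
      rw [hl'] at hch hfs hlen
      refine ⟨l', hch, ?_, ?_, ?_⟩
      · rw [hfs]; exact Finset.insert_subset hb h2
      · rw [hfs, Finset.card_insert_of_notMem hbn, h3]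
      · simp at hlen; omega
  have hpos : 0 < S.card := Finset.card_pos.2 ⟨e, he⟩
  obtain ⟨l, h1, h2, h3, h4⟩ := key (S.card - 1) (by omega)
  exact ⟨l, h1, Finset.eq_of_subset_of_card_le h2 (by omega), by omega⟩

theorem walk_count {α : Type*} (nb : α → Finset α) (D : ℕ) (hD : ∀ a, (nb a).card ≤ D) (n : ℕ) :
    ∀ e : α, ∃ F : Finset (List α), F.card ≤ D ^ n ∧
      ∀ l : List α, (e :: l).IsChain (fun a b => b ∈ nb a) → l.length = n → l ∈ F := by
  induction n with
  | zero =>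
    intro e
    refine ⟨{[]}, by simp, ?_⟩
    intro l _ hl
    simpa using hl
  | succ n ih =>
    intro e
    choose F hF1 hF2 using ih
    refine ⟨(nb e).biUnion fun a => (F a).image (a :: ·), ?_, ?_⟩
    · refine (Finset.card_biUnion_le_card_mul _ _ (D ^ n) ?_).trans ?_
      · intro a _
        exact Finset.card_image_le.trans (hF1 a)
      · rw [pow_succ, mul_comm]; exact Nat.mul_le_mul_left _ (hD e)
    · intro l hl hn
      cases l with
      | nil => simp at hn
      | cons a l =>
        rw [List.isChain_cons_cons] at hl
        simp only [Finset.mem_biUnion, Finset.mem_image]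
        exact ⟨a, hl.1, l, hF2 a l hl.2 (by simpa using hn), rfl⟩

/-- Counting connected sets of given size containing a given point. -/
theorem animal_count {α : Type*} (nb : α → Finset α) (D : ℕ) (hD : ∀ a, (nb a).card ≤ D)
    (hs : ∀ a b, b ∈ nb a → a ∈ nb b) (e : α) (n : ℕ) (F : Finset (Finset α))
    (hF : ∀ S ∈ F, e ∈ S ∧ S.card = n ∧
      ∀ E1 ⊆ S, e ∈ E1 → (∀ a ∈ E1, ∀ b ∈ S, b ∈ nb a → b ∈ E1) → E1 = S) :
    F.card ≤ D ^ (2 * n - 2) := by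
  obtain ⟨G, hG1, hG2⟩ := walk_count nb D hD (2 * n - 2) e
  refine le_trans ?_ hG1
  have : F ⊆ G.image (fun l => (e :: l).toFinset) := by
    intro S hS
    obtain ⟨h1, h2, h3⟩ := hF S hS
    obtain ⟨l, hl1, hl2, hl3⟩ := walk_exists (fun a b => b ∈ nb a) hs S e h1 h3
    exact Finset.mem_image.2 ⟨l, hG2 l hl1 (by omega), hl2⟩
  exact (Finset.card_le_card this).trans Finset.card_image_le
end PartA

section PartB
attribute [local instance] Classical.propDecidable

variable {P : Type*}

/-- weight of a multiset of polymers. -/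
noncomputable def polyF (C : P → P → Prop) (W : P → ℝ) (A : Finset P) (Γ : Multiset P) : ℝ :=
  Set.indicator {Γ : Multiset P | (∀ γ ∈ Γ, γ ∈ A) ∧ ∀ γ ∈ Γ, ∀ γ' ∈ Γ, C γ γ'}
    (fun Γ => (Γ.map W).prod) Γ

noncomputable def polyZ (C : P → P → Prop) (W : P → ℝ) (A : Finset P) : ℝ :=
  ∑' Γ, polyF C W A Γ

def inc (C : P → P → Prop) (γ γ' : P) : Prop := ¬ (C γ γ' ∧ C γ' γ)

theorem polyF_nonneg (C : P → P → Prop) (W : P → ℝ) (A : Finset P) (hW : ∀ γ ∈ A, 0 ≤ W γ)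
    (Γ : Multiset P) : 0 ≤ polyF C W A Γ := by
  unfold polyF
  apply Set.indicator_apply_nonneg
  intro h
  apply Multiset.prod_nonneg
  intro a ha
  obtain ⟨b, hb, rfl⟩ := Multiset.mem_map.1 ha
  exact hW b (h.1 b hb)

theorem polyF_of (C : P → P → Prop) (W : P → ℝ) (A : Finset P) (Γ : Multiset P)
    (h1 : ∀ γ ∈ Γ, γ ∈ A) (h2 : ∀ γ ∈ Γ, ∀ γ' ∈ Γ, C γ γ') :
    polyF C W A Γ = (Γ.map W).prod := by
  unfold polyF
  rw [Set.indicator_of_mem]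
  exact ⟨h1, h2⟩

theorem polyF_ne (C : P → P → Prop) (W : P → ℝ) (A : Finset P) (Γ : Multiset P)
    (h : polyF C W A Γ ≠ 0) : (∀ γ ∈ Γ, γ ∈ A) ∧ ∀ γ ∈ Γ, ∀ γ' ∈ Γ, C γ γ' := by
  unfold polyF at h
  have h2 := Set.mem_of_indicator_ne_zero h
  exact h2

theorem poly_rec_aux (C : P → P → Prop) (W : P → ℝ) (hC : ∀ γ, C γ γ) (A : Finset P)
    (hW : ∀ γ ∈ A, 0 ≤ W γ ∧ W γ < 1) (γ : P) (hγ : γ ∈ A)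
    (hs : Summable (polyF C W (A.erase γ)))
    (hs2 : Summable (polyF C W ((A.erase γ).filter fun x => ¬ inc C γ x))) :
    HasSum (polyF C W A) (polyZ C W (A.erase γ) +
      W γ / (1 - W γ) * polyZ C W ((A.erase γ).filter fun x => ¬ inc C γ x)) := by
  set B := (A.erase γ).filter fun x => ¬ inc C γ x with hB
  have hmemB : ∀ x, x ∈ B ↔ (x ≠ γ ∧ x ∈ A) ∧ (C γ x ∧ C x γ) := by
    intro x; simp [hB, inc]
  obtain ⟨hW0, hW1⟩ := hW γ hγ
  have hdec : polyF C W A = fun Γ => polyF C W (A.erase γ) Γ +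
      (if γ ∈ Γ then polyF C W A Γ else 0) := by
    funext Γ
    by_cases hg : γ ∈ Γ
    · have : polyF C W (A.erase γ) Γ = 0 := by
        by_contra h
        have := (polyF_ne C W _ Γ h).1 γ hg
        simp at this
      simp [hg, this]
    · simp only [hg, if_false, add_zero]
      unfold polyF
      simp only [Set.indicator]
      congr 1
      apply propext
      simp only [Set.mem_ofPred_eq, Finset.mem_erase]
      constructor
      · rintro ⟨h1, h2⟩
        exact ⟨fun x hx => ⟨fun h => hg (h ▸ hx), h1 x hx⟩, h2⟩
      · rintro ⟨h1, h2⟩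
        exact ⟨fun x hx => (h1 x hx).2, h2⟩
  rw [hdec]
  refine HasSum.add hs.hasSum ?_
  have hgeo : HasSum (fun k : ℕ => W γ ^ (k + 1)) (W γ / (1 - W γ)) := by
    have := (hasSum_geometric_of_lt_one hW0 hW1).mul_left (W γ)
    simpa [pow_succ, mul_comm, div_eq_mul_inv] using this
  have hprod : HasSum (fun p : ℕ × Multiset P => W γ ^ (p.1 + 1) * polyF C W B p.2)
      (W γ / (1 - W γ) * polyZ C W B) := by
    have hsm := hgeo.summable.mul_of_nonneg hs2 (fun k => pow_nonneg hW0 _)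
      (fun Γ => polyF_nonneg C W B (fun x hx => (hW x ((hmemB x).1 hx).1.2).1) Γ)
    exact hgeo.mul hs2.hasSum hsm
  refine (hasSum_iff_hasSum_of_ne_zero_bij
    (f := fun Γ => if γ ∈ Γ then polyF C W A Γ else 0)
    (g := fun p : ℕ × Multiset P => W γ ^ (p.1 + 1) * polyF C W B p.2)
    (fun p => Multiset.replicate (p.1.1 + 1) γ + p.1.2) ?_ ?_ ?_).2 hprod
  · rintro ⟨⟨k, Γ⟩, hp⟩ ⟨⟨k', Γ'⟩, hp'⟩ heq
    have h1 := (polyF_ne C W B Γ (right_ne_zero_of_mul hp)).1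
    have h1' := (polyF_ne C W B Γ' (right_ne_zero_of_mul hp')).1
    have hn : γ ∉ Γ := fun h => ((hmemB _).1 (h1 γ h)).1.1 rfl
    have hn' : γ ∉ Γ' := fun h => ((hmemB _).1 (h1' γ h)).1.1 rfl
    simp only at heq
    have hk : k = k' := by
      have := congrArg (Multiset.count γ) heq
      simp [Multiset.count_eq_zero_of_notMem hn, Multiset.count_eq_zero_of_notMem hn'] at this
      exact this
    subst hk
    have := add_left_cancel heq
    subst this
    rfl
  · intro Γ hΓ
    simp only [Function.mem_support, ne_eq, ite_eq_right_iff, Classical.not_imp] at hΓ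
    obtain ⟨hg, hne⟩ := hΓ
    obtain ⟨h1, h2⟩ := polyF_ne C W A Γ hne
    have hcount : 0 < Multiset.count γ Γ := Multiset.count_pos.2 hg
    have hsplit : Multiset.replicate (Multiset.count γ Γ - 1 + 1) γ + Γ.filter (fun x => x ≠ γ) = Γ := by
      rw [Nat.sub_add_cancel hcount]
      ext x
      rw [Multiset.count_add, Multiset.count_replicate, Multiset.count_filter]
      by_cases hx : x = γ
      · subst hx; simp
      · have : ¬ γ = x := fun h => hx h.symm
        simp [hx, this]
    have hBm : ∀ x ∈ Γ.filter (fun x => x ≠ γ), x ∈ B := by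
      intro x hx
      rw [Multiset.mem_filter] at hx
      exact (hmemB x).2 ⟨⟨hx.2, h1 x hx.1⟩, h2 _ hg _ hx.1, h2 _ hx.1 _ hg⟩
    have hBf : polyF C W B (Γ.filter (fun x => x ≠ γ)) = ((Γ.filter (fun x => x ≠ γ)).map W).prod :=
      polyF_of C W B _ hBm (fun x hx y hy => h2 x (Multiset.mem_of_mem_filter hx) y
        (Multiset.mem_of_mem_filter hy))
    refine ⟨⟨(Multiset.count γ Γ - 1, Γ.filter (fun x => x ≠ γ)), ?_⟩, hsplit⟩
    rw [Function.mem_support]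
    simp only
    rw [hBf]
    rw [polyF_of C W A Γ h1 h2] at hne
    rw [← hsplit, Multiset.map_add, Multiset.prod_add, Multiset.map_replicate,
      Multiset.prod_replicate] at hne
    exact hne
  · rintro ⟨⟨k, Γ⟩, hp⟩
    obtain ⟨h1, h2⟩ := polyF_ne C W B Γ (right_ne_zero_of_mul hp)
    have hmem : γ ∈ Multiset.replicate (k + 1) γ + Γ := by
      rw [Multiset.mem_add]; left; simp
    simp only [hmem, if_true]
    rw [polyF_of C W A, polyF_of C W B Γ h1 h2, Multiset.map_add, Multiset.prod_add,
      Multiset.map_replicate, Multiset.prod_replicate]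
    · intro x hx
      rw [Multiset.mem_add] at hx
      rcases hx with hx | hx
      · rw [Multiset.eq_of_mem_replicate hx]; exact hγ
      · exact ((hmemB x).1 (h1 x hx)).1.2
    · intro x hx y hy
      rw [Multiset.mem_add] at hx hy
      rcases hx with hx | hx <;> rcases hy with hy | hy
      · rw [Multiset.eq_of_mem_replicate hx, Multiset.eq_of_mem_replicate hy]; exact hC γ
      · rw [Multiset.eq_of_mem_replicate hx]; exact ((hmemB y).1 (h1 y hy)).2.1
      · rw [Multiset.eq_of_mem_replicate hy]; exact ((hmemB x).1 (h1 x hx)).2.2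
      · exact h2 x hx y hy

theorem poly_summable (C : P → P → Prop) (W : P → ℝ) (hC : ∀ γ, C γ γ) (n : ℕ) :
    ∀ A : Finset P, A.card ≤ n → (∀ γ ∈ A, 0 ≤ W γ ∧ W γ < 1) → Summable (polyF C W A) := by
  induction n with
  | zero =>
    intro A hA _
    have hA0 : A = ∅ := Finset.card_eq_zero.1 (Nat.le_zero.1 hA)
    subst hA0
    apply summable_of_ne_finset_zero (s := {0})
    intro Γ hΓ
    by_contra h
    apply hΓ
    have := (polyF_ne C W _ Γ h).1
    simp at this
    simpa using Multiset.eq_zero_of_forall_notMem this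
  | succ n ih =>
    intro A hA hW
    rcases A.eq_empty_or_nonempty with h | ⟨γ, hγ⟩
    · exact ih A (by simp [h]) hW
    · have hc : (A.erase γ).card ≤ n := by
        rw [Finset.card_erase_of_mem hγ]; omega
      refine (poly_rec_aux C W hC A hW γ hγ (ih _ hc ?_) (ih _ ?_ ?_)).summable
      · intro x hx; exact hW x (Finset.mem_of_mem_erase hx)
      · exact (Finset.card_filter_le _ _).trans hc
      · intro x hx; exact hW x (Finset.mem_of_mem_erase (Finset.mem_of_mem_filter x hx))

theorem poly_rec (C : P → P → Prop) (W : P → ℝ) (hC : ∀ γ, C γ γ) (A : Finset P)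
    (hW : ∀ γ ∈ A, 0 ≤ W γ ∧ W γ < 1) (γ : P) (hγ : γ ∈ A) :
    polyZ C W A = polyZ C W (A.erase γ) +
      W γ / (1 - W γ) * polyZ C W ((A.erase γ).filter fun x => ¬ inc C γ x) := by
  refine (poly_rec_aux C W hC A hW γ hγ ?_ ?_).tsum_eq
  · exact poly_summable C W hC _ _ le_rfl fun x hx => hW x (Finset.mem_of_mem_erase hx)
  · exact poly_summable C W hC _ _ le_rfl fun x hx =>
      hW x (Finset.mem_of_mem_erase (Finset.mem_of_mem_filter x hx))

theorem polyZ_pos (C : P → P → Prop) (W : P → ℝ) (hC : ∀ γ, C γ γ) (A : Finset P)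
    (hW : ∀ γ ∈ A, 0 ≤ W γ ∧ W γ < 1) : 0 < polyZ C W A := by
  have h := (poly_summable C W hC _ A le_rfl hW).le_tsum 0
    (fun Γ _ => polyF_nonneg C W A (fun x hx => (hW x hx).1) Γ)
  rw [polyF_of C W A 0 (by simp) (by simp)] at h
  simp at h
  exact lt_of_lt_of_le one_pos h

theorem polyZ_mono (C : P → P → Prop) (W : P → ℝ) (hC : ∀ γ, C γ γ) (A B : Finset P)
    (hBA : B ⊆ A) (hW : ∀ γ ∈ A, 0 ≤ W γ ∧ W γ < 1) : polyZ C W B ≤ polyZ C W A := by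
  refine Summable.tsum_le_tsum ?_ (poly_summable C W hC _ B le_rfl fun x hx => hW x (hBA hx))
    (poly_summable C W hC _ A le_rfl hW)
  intro Γ
  by_cases h : polyF C W B Γ = 0
  · rw [h]; exact polyF_nonneg C W A (fun x hx => (hW x hx).1) Γ
  · obtain ⟨h1, h2⟩ := polyF_ne C W B Γ h
    rw [polyF_of C W B Γ h1 h2, polyF_of C W A Γ (fun x hx => hBA (h1 x hx)) h2]

theorem log_lip (w x y : ℝ) (hw : 0 ≤ w) (hx : 0 ≤ x) (hy : 0 ≤ y) :
    |Real.log (1 + w * Real.exp (-x)) - Real.log (1 + w * Real.exp (-y))| ≤ w * |x - y| := by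
  wlog hxy : x ≤ y generalizing x y
  · rw [abs_sub_comm, abs_sub_comm x y]
    exact this y x hy hx (le_of_not_ge hxy)
  have e1 : 0 < Real.exp (-x) := Real.exp_pos _
  have e2 : 0 < Real.exp (-y) := Real.exp_pos _
  have hexy : Real.exp (-y) ≤ Real.exp (-x) := Real.exp_le_exp.2 (by linarith)
  have p1 : 0 < 1 + w * Real.exp (-x) := by positivity
  have p2 : 0 < 1 + w * Real.exp (-y) := by positivity
  have hle : Real.log (1 + w * Real.exp (-y)) ≤ Real.log (1 + w * Real.exp (-x)) := by
    apply Real.log_le_log p2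
    have := mul_le_mul_of_nonneg_left hexy hw
    linarith
  rw [abs_of_nonneg (by linarith), abs_of_nonpos (by linarith), ← Real.log_div p1.ne' p2.ne']
  have h1 := Real.log_le_sub_one_of_pos (div_pos p1 p2)
  refine h1.trans ?_
  rw [div_sub_one p2.ne', div_le_iff₀ p2]
  have hd : Real.exp (-x) - Real.exp (-y) ≤ (y - x) := by
    have : Real.exp (-y) = Real.exp (-x) * Real.exp (-(y - x)) := by
      rw [← Real.exp_add]; ring_nf
    rw [this]
    have h3 := Real.add_one_le_exp (-(y - x))
    have h4 : Real.exp (-x) ≤ 1 := Real.exp_le_one_iff.2 (by linarith)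
    have h5 : 1 - Real.exp (-(y-x)) ≤ y - x := by linarith
    have h6 : 0 ≤ 1 - Real.exp (-(y-x)) := by
      have := Real.exp_le_one_iff.2 (show -(y-x) ≤ 0 by linarith)
      linarith
    nlinarith
  have h7 : 0 ≤ w * Real.exp (-y) := by positivity
  have h8 : w * (Real.exp (-x) - Real.exp (-y)) ≤ w * (y - x) := mul_le_mul_of_nonneg_left hd hw
  have h9 : 0 ≤ w * (y - x) := mul_nonneg hw (by linarith)
  nlinarith

theorem poly_logstep (C : P → P → Prop) (W : P → ℝ) (hC : ∀ γ, C γ γ) (A : Finset P)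
    (hW : ∀ γ ∈ A, 0 ≤ W γ ∧ W γ < 1) (γ : P) (hγ : γ ∈ A) :
    Real.log (polyZ C W A) - Real.log (polyZ C W (A.erase γ)) =
      Real.log (1 + W γ / (1 - W γ) * Real.exp (-(Real.log (polyZ C W (A.erase γ)) -
        Real.log (polyZ C W ((A.erase γ).filter fun x => ¬ inc C γ x))))) := by
  have p1 : 0 < polyZ C W A := polyZ_pos C W hC A hW
  have p2 : 0 < polyZ C W (A.erase γ) := polyZ_pos C W hC _
    fun x hx => hW x (Finset.mem_of_mem_erase hx)
  have p3 : 0 < polyZ C W ((A.erase γ).filter fun x => ¬ inc C γ x) := polyZ_pos C W hC _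
    fun x hx => hW x (Finset.mem_of_mem_erase (Finset.mem_of_mem_filter x hx))
  rw [← Real.log_div p1.ne' p2.ne', neg_sub, Real.exp_sub, Real.exp_log p2, Real.exp_log p3,
    poly_rec C W hC A hW γ hγ]
  congr 1
  field_simp

/-- The comparison lemma. -/
theorem poly_compare (C : P → P → Prop) (W g : P → ℝ) (hC : ∀ γ, C γ γ) (D : Set P) (n : ℕ) :
    ∀ A A' : Finset P, (A ∪ A').card ≤ n → (∀ γ ∈ A ∪ A', 0 ≤ W γ ∧ W γ < 1) →
    (∀ γ ∈ A ∪ A', 0 ≤ g γ) →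
    (∀ γ ∈ A ∪ A', γ ∈ D → W γ / (1 - W γ) ≤ g γ) →
    (∀ γ ∈ A ∪ A', ∀ T ⊆ A ∪ A', (∀ x ∈ T, inc C γ x) →
      W γ / (1 - W γ) * ∑ x ∈ T, g x ≤ g γ) →
    (∀ γ ∈ A, γ ∉ A' → γ ∈ D) → (∀ γ ∈ A', γ ∉ A → γ ∈ D) →
    ∀ S : Set P,
    |(Real.log (polyZ C W A) - Real.log (polyZ C W (A.filter (· ∉ S)))) -
      (Real.log (polyZ C W A') - Real.log (polyZ C W (A'.filter (· ∉ S))))| ≤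
      ∑ γ ∈ (A ∪ A').filter (· ∈ S), g γ := by
  induction n with
  | zero =>
    intro A A' hcard _ _ _ _ _ _ S
    have h0 : A ∪ A' = ∅ := Finset.card_eq_zero.1 (Nat.le_zero.1 hcard)
    obtain ⟨h1, h2⟩ := Finset.union_eq_empty.1 h0
    subst h1 h2
    simp
  | succ n ih =>
    intro A A' hcard hW hg hD hKP hAA hAA' S
    by_cases hex : ∃ γ ∈ A ∪ A', γ ∈ S
    swap
    · push Not at hex
      have e1 : A.filter (· ∉ S) = A := Finset.filter_true_of_mem fun x hx =>
        hex x (Finset.mem_union_left _ hx)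
      have e2 : A'.filter (· ∉ S) = A' := Finset.filter_true_of_mem fun x hx =>
        hex x (Finset.mem_union_right _ hx)
      rw [e1, e2]
      simp only [sub_self, abs_zero]
      exact Finset.sum_nonneg fun x hx => hg x (Finset.mem_of_mem_filter x hx)
    obtain ⟨γ, hγ, hγS⟩ := hex
    have hun : A.erase γ ∪ A'.erase γ = (A ∪ A').erase γ := by
      ext x; simp; tauto
    have hsub : A.erase γ ∪ A'.erase γ ⊆ A ∪ A' := by
      rw [hun]; exact Finset.erase_subset _ _
    have hcard' : (A.erase γ ∪ A'.erase γ).card ≤ n := by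
      rw [hun, Finset.card_erase_of_mem hγ]; omega
    have IH := ih (A.erase γ) (A'.erase γ) hcard' (fun x hx => hW x (hsub hx))
      (fun x hx => hg x (hsub hx)) (fun x hx => hD x (hsub hx))
      (fun x hx T hT => hKP x (hsub hx) T (hT.trans hsub))
      (by
        intro x hx hx'
        rw [Finset.mem_erase] at hx hx'
        exact hAA x hx.2 fun h => hx' ⟨hx.1, h⟩)
      (by
        intro x hx hx'
        rw [Finset.mem_erase] at hx hx'
        exact hAA' x hx.2 fun h => hx' ⟨hx.1, h⟩)
    have hfe : ∀ X : Finset P, (X.erase γ).filter (· ∉ S) = X.filter (· ∉ S) := by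
      intro X
      ext x
      simp only [Finset.mem_filter, Finset.mem_erase]
      constructor
      · rintro ⟨⟨_, h⟩, h'⟩; exact ⟨h, h'⟩
      · rintro ⟨h, h'⟩; exact ⟨⟨fun he => h' (he ▸ hγS), h⟩, h'⟩
    have IHS := IH S
    rw [hfe, hfe] at IHS
    have hsum : ∑ x ∈ (A ∪ A').filter (· ∈ S), g x =
        g γ + ∑ x ∈ (A.erase γ ∪ A'.erase γ).filter (· ∈ S), g x := by
      rw [hun, Finset.filter_erase]
      rw [Finset.add_sum_erase _ _ (Finset.mem_filter.2 ⟨hγ, hγS⟩)]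
    have hw0 : 0 ≤ W γ / (1 - W γ) := div_nonneg (hW γ hγ).1 (by linarith [(hW γ hγ).2])
    -- the one-step increments
    have bound0 : ∀ X : Finset P, X ⊆ A ∪ A' → γ ∈ X →
        0 ≤ Real.log (polyZ C W X) - Real.log (polyZ C W (X.erase γ)) ∧
        Real.log (polyZ C W X) - Real.log (polyZ C W (X.erase γ)) ≤ W γ / (1 - W γ) := by
      intro X hX hγX
      have hWX : ∀ x ∈ X, 0 ≤ W x ∧ W x < 1 := fun x hx => hW x (hX hx)
      have hWX' : ∀ x ∈ X.erase γ, 0 ≤ W x ∧ W x < 1 := fun x hx =>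
        hWX x (Finset.mem_of_mem_erase hx)
      rw [poly_logstep C W hC X hWX γ hγX]
      have hmono : 0 ≤ Real.log (polyZ C W (X.erase γ)) -
          Real.log (polyZ C W ((X.erase γ).filter fun x => ¬ inc C γ x)) := by
        rw [sub_nonneg]
        exact Real.log_le_log (polyZ_pos C W hC _ fun x hx =>
          hWX' x (Finset.mem_of_mem_filter x hx))
          (polyZ_mono C W hC _ _ (Finset.filter_subset _ _) hWX')
      set u := Real.log (polyZ C W (X.erase γ)) -
          Real.log (polyZ C W ((X.erase γ).filter fun x => ¬ inc C γ x))
      have hu : 0 < Real.exp (-u) := Real.exp_pos _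
      have hu1 : Real.exp (-u) ≤ 1 := Real.exp_le_one_iff.2 (by linarith)
      constructor
      · apply Real.log_nonneg
        have := mul_nonneg hw0 hu.le
        linarith
      · have hp : 0 < 1 + W γ / (1 - W γ) * Real.exp (-u) := by positivity
        have := Real.log_le_sub_one_of_pos hp
        nlinarith
    have hgγ : |(Real.log (polyZ C W A) - Real.log (polyZ C W (A.erase γ))) -
        (Real.log (polyZ C W A') - Real.log (polyZ C W (A'.erase γ)))| ≤ g γ := by
      by_cases h1 : γ ∈ A <;> by_cases h2 : γ ∈ A'
      · have hWA : ∀ x ∈ A, 0 ≤ W x ∧ W x < 1 := fun x hx => hW x (Finset.mem_union_left _ hx)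
        have hWA' : ∀ x ∈ A', 0 ≤ W x ∧ W x < 1 := fun x hx => hW x (Finset.mem_union_right _ hx)
        rw [poly_logstep C W hC A hWA γ h1, poly_logstep C W hC A' hWA' γ h2]
        have hm : ∀ X : Finset P, (∀ x ∈ X, 0 ≤ W x ∧ W x < 1) →
          0 ≤ Real.log (polyZ C W (X.erase γ)) -
            Real.log (polyZ C W ((X.erase γ).filter fun x => ¬ inc C γ x)) := by
          intro X hX
          rw [sub_nonneg]
          exact Real.log_le_log (polyZ_pos C W hC _ fun x hx =>
            hX x (Finset.mem_of_mem_erase (Finset.mem_of_mem_filter x hx)))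
            (polyZ_mono C W hC _ _ (Finset.filter_subset _ _)
              fun x hx => hX x (Finset.mem_of_mem_erase hx))
        refine (log_lip _ _ _ hw0 (hm A hWA) (hm A' hWA')).trans ?_
        have IHN := IH {x | inc C γ x}
        simp only [Set.mem_ofPred_eq] at IHN
        refine (mul_le_mul_of_nonneg_left IHN hw0).trans ?_
        refine hKP γ hγ _ ((Finset.filter_subset _ _).trans hsub) ?_
        intro x hx
        exact (Finset.mem_filter.1 hx).2
      · rw [Finset.erase_eq_of_notMem h2, sub_self, sub_zero]
        obtain ⟨b1, b2⟩ := bound0 A Finset.subset_union_left h1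
        rw [abs_of_nonneg b1]
        exact b2.trans (hD γ hγ (hAA γ h1 h2))
      · rw [Finset.erase_eq_of_notMem h1, sub_self, zero_sub, abs_neg]
        obtain ⟨b1, b2⟩ := bound0 A' Finset.subset_union_right h2
        rw [abs_of_nonneg b1]
        exact b2.trans (hD γ hγ (hAA' γ h2 h1))
      · exfalso
        rcases Finset.mem_union.1 hγ with h | h
        · exact h1 h
        · exact h2 h
    rw [hsum]
    have := abs_add_le _ _ |>.trans (add_le_add hgγ IHS)
    refine le_trans (le_of_eq ?_) this
    congr 1
    ring
end PartB

section PartC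
attribute [local instance] Classical.propDecidable

theorem mem_dirs {d : Site} : d ∈ dirs ↔ d = (1, 0) ∨ d = (-1, 0) ∨ d = (0, 1) ∨ d = (0, -1) := by
  simp [dirs]

theorem neg_mem_dirs {d : Site} (h : d ∈ dirs) : -d ∈ dirs := by
  rw [mem_dirs] at h ⊢
  rcases h with h | h | h | h <;> subst h <;> simp

theorem adjS_symm {u v : Site} (h : adjS u v) : adjS v u := by
  unfold adjS at *
  have := neg_mem_dirs h
  rwa [neg_sub] at this

/-- Boundary darts of a set of sites. -/
noncomputable def bd (A : Finset Site) : Finset (Site × Site) :=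
  (A ×ˢ dirs).filter fun p => p.1 + p.2 ∉ A

theorem mem_bd {A : Finset Site} {p : Site × Site} :
    p ∈ bd A ↔ p.1 ∈ A ∧ p.2 ∈ dirs ∧ p.1 + p.2 ∉ A := by
  simp [bd, and_assoc]

theorem card_bd (A : Finset Site) : (bd A).card = edgeBdryCard A := by
  unfold bd edgeBdryCard
  rw [Finset.card_filter, Finset.sum_product]
  apply Finset.sum_congr rfl
  intro v _
  rw [Finset.card_filter]

def nearS (u v : Site) : Prop := |u.1 - v.1| ≤ 1 ∧ |u.2 - v.2| ≤ 1

theorem nearS_symm {u v : Site} (h : nearS u v) : nearS v u := by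
  unfold nearS at *
  rwa [abs_sub_comm, abs_sub_comm v.2]

noncomputable def nbD (p : Site × Site) : Finset (Site × Site) :=
  ((Finset.Icc (p.1.1 - 1) (p.1.1 + 1) ×ˢ Finset.Icc (p.1.2 - 1) (p.1.2 + 1)) ×ˢ dirs).filter
    fun _ => p.2 ∈ dirs

theorem mem_nbD {p q : Site × Site} : q ∈ nbD p ↔ nearS p.1 q.1 ∧ q.2 ∈ dirs ∧ p.2 ∈ dirs := by
  simp only [nbD, Finset.mem_filter, Finset.mem_product, Finset.mem_Icc, nearS, abs_le]
  constructor
  · rintro ⟨⟨⟨⟨h1, h2⟩, h3, h4⟩, h5⟩, h6⟩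
    exact ⟨⟨⟨by omega, by omega⟩, by omega, by omega⟩, h5, h6⟩
  · rintro ⟨⟨⟨h1, h2⟩, h3, h4⟩, h5, h6⟩
    exact ⟨⟨⟨⟨by omega, by omega⟩, by omega, by omega⟩, h5⟩, h6⟩

theorem card_dirs : dirs.card ≤ 4 := by
  unfold dirs
  exact Finset.card_le_four

theorem card_nbD (p : Site × Site) : (nbD p).card ≤ 36 := by
  unfold nbD
  refine (Finset.card_filter_le _ _).trans ?_
  rw [Finset.card_product, Finset.card_product, Int.card_Icc, Int.card_Icc]
  have h1 : (p.1.1 + 1 + 1 - (p.1.1 - 1)).toNat = 3 := by omega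
  have h2 : (p.1.2 + 1 + 1 - (p.1.2 - 1)).toNat = 3 := by omega
  rw [h1, h2]
  have := card_dirs
  omega

theorem conn_exit {S : Set Site} (hS : connectedIn S) (p : Site → Prop) {x y : Site}
    (hx : x ∈ S) (hy : y ∈ S) (px : p x) (py : ¬ p y) :
    ∃ a b, a ∈ S ∧ b ∈ S ∧ adjS a b ∧ p a ∧ ¬ p b := by
  by_contra hcon
  push Not at hcon
  have h := hS x hx y hy
  apply py
  clear py hy
  induction h with
  | refl => exact px
  | tail _ h2 ih => exact hcon _ _ h2.2.1 h2.2.2 h2.1 ih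

theorem int_prim (g : ℤ → ZMod 2) :
    ∃ F : ℤ → ZMod 2, F 0 = 0 ∧ ∀ n, F (n + 1) = F n + g n := by
  refine ⟨fun n => ∑ i ∈ Finset.Ico 0 n, g i + ∑ i ∈ Finset.Ico n 0, g i, by simp, ?_⟩
  intro n
  rcases le_or_gt 0 n with h | h
  · have e1 : Finset.Ico 0 (n + 1) = insert n (Finset.Ico 0 n) := by
      ext i; simp; omega
    have e2 : Finset.Ico n 0 = ∅ := by ext i; simp; omega
    have e3 : Finset.Ico (n + 1) 0 = ∅ := by ext i; simp; omega
    simp only [e1, e2, e3]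
    rw [Finset.sum_insert (by simp)]
    simp [add_comm]
  · have e1 : Finset.Ico n 0 = insert n (Finset.Ico (n + 1) 0) := by
      ext i; simp; omega
    have e2 : Finset.Ico 0 n = ∅ := by ext i; simp; omega
    have e3 : Finset.Ico 0 (n + 1) = ∅ := by ext i; simp; omega
    simp only [e1, e2, e3]
    rw [Finset.sum_insert (by simp)]
    simp only [Finset.sum_empty, zero_add]
    generalize ∑ i ∈ Finset.Ico (n + 1) 0, g i = s
    generalize g n = t
    revert s t
    decide

theorem poincare2 (H V : ℤ → ℤ → ZMod 2)
    (h : ∀ x y, H x y + V (x + 1) y + H x (y + 1) + V x y = 0) :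
    ∃ f : ℤ → ℤ → ZMod 2, (∀ x y, f (x + 1) y = f x y + H x y) ∧
      ∀ x y, f x (y + 1) = f x y + V x y := by
  obtain ⟨F0, -, hF0⟩ := int_prim fun x => H x 0
  choose G hG0 hG using fun x => int_prim (V x)
  have ar : ∀ a b : ZMod 2, a = b ↔ a + b = 0 := by decide
  have step : ∀ x y, (F0 (x + 1) + G (x + 1) (y + 1)) + (F0 x + G x (y + 1) + H x (y + 1)) =
      (F0 (x + 1) + G (x + 1) y) + (F0 x + G x y + H x y) := by
    intro x y
    rw [hG, hG]
    have := h x y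
    generalize F0 (x + 1) = a at *
    generalize G (x + 1) y = b at *
    generalize V (x + 1) y = c at *
    generalize F0 x = d at *
    generalize G x y = e at *
    generalize V x y = e' at *
    generalize H x (y + 1) = eThr at *
    generalize H x y = eFour at *
    have h4 : ∀ a b c d : ZMod 2, a + b + c + d = 0 → b + (d + c) = a := by decide
    have h5 := h4 _ _ _ _ this
    calc _ = a + b + (d + e) + (c + (e' + eThr)) := by ring
      _ = _ := by rw [h5]; ring
  refine ⟨fun x y => F0 x + G x y, ?_, ?_⟩
  · intro x y
    rw [ar]
    induction y using Int.induction_on with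
    | zero => simp only; rw [hG0, hG0, add_zero, add_zero, ← ar]; exact hF0 x
    | succ i ih => rw [step]; exact ih
    | pred i ih =>
      have := step x (-(i : ℤ) - 1)
      rw [sub_add_cancel] at this
      rw [← this]; exact ih
  · intro x y
    simp only
    rw [hG, add_assoc]

/-- Boundary connectivity (following Timar). -/
theorem bd_conn (A : Finset Site) (hA : connectedIn (↑A : Set Site))
    (hAc : connectedIn ((↑A : Set Site)ᶜ)) (E : Finset (Site × Site)) (hE : E ⊆ bd A)
    (e : Site × Site) (he : e ∈ E)
    (hcl : ∀ a ∈ E, ∀ b ∈ bd A, nearS a.1 b.1 → b ∈ E) : E = bd A := by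
  set c : Site → Site → ZMod 2 := fun u v => if (u, v - u) ∈ E ∨ (v, u - v) ∈ E then 1 else 0 with hc
  have csymm : ∀ u v, c u v = c v u := by
    intro u v; simp only [hc]; congr 1; apply propext; tauto
  set ι : Site → ZMod 2 := fun u => if u ∈ A then 1 else 0 with hι
  have hcι : ∀ e0 ∈ E, ∀ u v, v - u ∈ dirs → nearS e0.1 u → nearS e0.1 v → c u v = ι u + ι v := by
    intro e0 he0 u v hd hu hv
    have hd' : u - v ∈ dirs := by have := neg_mem_dirs hd; rwa [neg_sub] at this
    have m1 : (u, v - u) ∈ E ↔ u ∈ A ∧ v ∉ A := by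
      constructor
      · intro h; have := mem_bd.1 (hE h); simp at this; exact ⟨this.1, this.2.2⟩
      · rintro ⟨h1, h2⟩
        exact hcl e0 he0 _ (mem_bd.2 ⟨h1, hd, by simpa using h2⟩) hu
    have m2 : (v, u - v) ∈ E ↔ v ∈ A ∧ u ∉ A := by
      constructor
      · intro h; have := mem_bd.1 (hE h); simp at this; exact ⟨this.1, this.2.2⟩
      · rintro ⟨h1, h2⟩
        exact hcl e0 he0 _ (mem_bd.2 ⟨h1, hd', by simpa using h2⟩) hv
    simp only [hc, hι, m1, m2]
    by_cases h1 : u ∈ A <;> by_cases h2 : v ∈ A <;> simp [h1, h2]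
    all_goals decide
  have hc0 : ∀ u v, (∀ e0 ∈ E, e0.1 ≠ u ∧ e0.1 ≠ v) → c u v = 0 := by
    intro u v h
    simp only [hc]
    rw [if_neg]
    rintro (h' | h')
    · exact (h _ h').1 rfl
    · exact (h _ h').2 rfl
  obtain ⟨f, hf1, hf2⟩ := poincare2 (fun x y => c (x, y) (x + 1, y))
    (fun x y => c (x, y) (x, y + 1)) (by
      intro x y
      by_cases hex : ∃ e0 ∈ E, e0.1 = (x, y) ∨ e0.1 = (x + 1, y) ∨ e0.1 = (x, y + 1) ∨
          e0.1 = (x + 1, y + 1)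
      · obtain ⟨e0, he0, hor⟩ := hex
        have n1 : nearS e0.1 (x, y) := by
          rcases hor with h | h | h | h <;> rw [h] <;> simp [nearS]
        have n2 : nearS e0.1 (x + 1, y) := by
          rcases hor with h | h | h | h <;> rw [h] <;> simp [nearS]
        have n3 : nearS e0.1 (x, y + 1) := by
          rcases hor with h | h | h | h <;> rw [h] <;> simp [nearS]
        have n4 : nearS e0.1 (x + 1, y + 1) := by
          rcases hor with h | h | h | h <;> rw [h] <;> simp [nearS]
        rw [hcι e0 he0 _ _ (by simp [mem_dirs]) n1 n2, hcι e0 he0 _ _ (by simp [mem_dirs]) n2 n4,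
          hcι e0 he0 _ _ (by simp [mem_dirs]) n3 n4, hcι e0 he0 _ _ (by simp [mem_dirs]) n1 n3]
        generalize ι (x, y) = a
        generalize ι (x + 1, y) = b
        generalize ι (x, y + 1) = c
        generalize ι (x + 1, y + 1) = d
        revert a b c d
        decide
      · push Not at hex
        rw [hc0, hc0, hc0, hc0]
        · simp
        all_goals
          intro e0 he0
          obtain ⟨h1, h2, h3, h4⟩ := hex e0 he0
          constructor <;> assumption)
  have ar : ∀ a b c : ZMod 2, a = b + c → b = a + c := by decide
  have hf : ∀ u v, adjS u v → f v.1 v.2 = f u.1 u.2 + c u v := by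
    rintro ⟨x, y⟩ ⟨x', y'⟩ hadj
    unfold adjS at hadj
    rw [mem_dirs] at hadj
    simp only [Prod.mk_sub_mk, Prod.mk.injEq] at hadj
    rcases hadj with h | h | h | h
    · obtain rfl : x' = x + 1 := by omega
      obtain rfl : y' = y := by omega
      exact hf1 x y'
    · obtain rfl : x = x' + 1 := by omega
      obtain rfl : y' = y := by omega
      rw [csymm]
      exact ar _ _ _ (hf1 x' y')
    · obtain rfl : x' = x := by omega
      obtain rfl : y' = y + 1 := by omega
      exact hf2 x' y
    · obtain rfl : x' = x := by omega
      obtain rfl : y = y' + 1 := by omega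
      rw [csymm]
      exact ar _ _ _ (hf2 x' y')
  -- c vanishes inside A and inside the complement
  have cin : ∀ u v, u ∈ A → v ∈ A → c u v = 0 := by
    intro u v hu hv
    simp only [hc]
    rw [if_neg]
    rintro (h | h)
    · have := (mem_bd.1 (hE h)).2.2; simp at this; exact this hv
    · have := (mem_bd.1 (hE h)).2.2; simp at this; exact this hu
  have cout : ∀ u v, u ∉ A → v ∉ A → c u v = 0 := by
    intro u v hu hv
    simp only [hc]
    rw [if_neg]
    rintro (h | h)
    · exact hu (mem_bd.1 (hE h)).1
    · exact hv (mem_bd.1 (hE h)).1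
  have fconst : ∀ S : Set Site, connectedIn S → (∀ u ∈ S, ∀ v ∈ S, c u v = 0) →
      ∀ u ∈ S, ∀ v ∈ S, f u.1 u.2 = f v.1 v.2 := by
    intro S hS h0 u hu v hv
    by_contra hne
    obtain ⟨a, b, ha, hb, hab, p1, p2⟩ := conn_exit hS (fun w => f u.1 u.2 = f w.1 w.2) hu hv rfl hne
    apply p2
    rw [p1, hf a b hab, h0 a ha b hb, add_zero]
  have fA := fconst (↑A) hA (fun u hu v hv => cin u v (by simpa using hu) (by simpa using hv))
  have fAc := fconst ((↑A)ᶜ) hAc (fun u hu v hv => cout u v (by simpa using hu) (by simpa using hv))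
  have heb := mem_bd.1 (hE he)
  have hce : c e.1 (e.1 + e.2) = 1 := by
    simp only [hc]
    rw [if_pos]
    left
    simpa using he
  have adj' : ∀ p ∈ bd A, adjS p.1 (p.1 + p.2) := by
    intro p hp
    unfold adjS
    simpa using (mem_bd.1 hp).2.1
  refine Finset.Subset.antisymm hE ?_
  intro p hp
  have hpb := mem_bd.1 hp
  have h1 := hf _ _ (adj' p hp)
  have h2 := hf _ _ (adj' e (hE he))
  have h3 := fA p.1 (by simpa using hpb.1) e.1 (by simpa using heb.1)
  have h4 := fAc (p.1 + p.2) (by simpa using hpb.2.2) (e.1 + e.2) (by simpa using heb.2.2)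
  have hcp : c p.1 (p.1 + p.2) = 1 := by
    rw [h3, h4, h2, hce] at h1
    exact (add_left_cancel h1).symm
  simp only [hc] at hcp
  by_contra hpE
  rw [if_neg] at hcp
  · exact absurd hcp (by decide)
  · rintro (h | h)
    · apply hpE; simpa using h
    · exact hpb.2.2 (mem_bd.1 (hE h)).1

theorem bd_inj_sub (A B : Finset Site) (hA : connectedIn (↑A : Set Site)) (hne : (bd A).Nonempty)
    (h : bd A = bd B) : A ⊆ B := by
  obtain ⟨p, hp⟩ := hne
  have hpA := (mem_bd.1 hp).1
  have hpB := (mem_bd.1 (h ▸ hp)).1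
  intro y hy
  by_contra hyB
  obtain ⟨a, b, ha, hb, hab, h1, h2⟩ := conn_exit hA (fun v => v ∈ B) (by simpa using hpA)
    (by simpa using hy) hpB hyB
  have : (a, b - a) ∈ bd B := mem_bd.2 ⟨h1, hab, by simpa using h2⟩
  rw [← h] at this
  have := (mem_bd.1 this).2.2
  simp at this
  exact this (by simpa using hb)

theorem bd_inj (A B : Finset Site) (hA : connectedIn (↑A : Set Site))
    (hB : connectedIn (↑B : Set Site)) (hne : (bd A).Nonempty)
    (h : bd A = bd B) : A = B :=
  Finset.Subset.antisymm (bd_inj_sub A B hA hne h) (bd_inj_sub B A hB (h ▸ hne) h.symm)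

theorem bd_nonempty (A : Finset Site) (h : A.Nonempty) : (bd A).Nonempty := by
  obtain ⟨v, hv, hmax⟩ := Finset.exists_max_image A (fun v => v.2) h
  refine ⟨(v, (0, 1)), mem_bd.2 ⟨hv, by simp [mem_dirs], ?_⟩⟩
  intro hcon
  have := hmax _ hcon
  simp at this

theorem diam_aux1 (A : Finset Site) (hA : connectedIn (↑A : Set Site)) (y z : Site) (hy : y ∈ A)
    (hz : z ∈ A) (hyz : y.1 ≤ z.1) :
    z.1 - y.1 ≤ (((bd A).filter fun p => p.2 = (0, 1)).card : ℤ) := by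
  have hsub : Finset.Icc y.1 z.1 ⊆ ((bd A).filter fun p => p.2 = (0, 1)).image fun p => p.1.1 := by
    intro t ht
    rw [Finset.mem_Icc] at ht
    have hex : ∃ v ∈ A, v.1 = t := by
      rcases eq_or_lt_of_le ht.1 with h | h
      · exact ⟨y, hy, h⟩
      · obtain ⟨a, b, ha, hb, hab, h1, h2⟩ := conn_exit hA (fun v => v.1 < t)
          (by simpa using hy) (by simpa using hz) h (by omega)
        refine ⟨b, by simpa using hb, ?_⟩
        unfold adjS at hab
        rw [mem_dirs] at hab
        simp only [Prod.ext_iff, Prod.fst_sub, Prod.snd_sub] at hab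
        omega
    obtain ⟨v, hv, hvt⟩ := hex
    obtain ⟨u, hu, hmax⟩ := Finset.exists_max_image (A.filter fun u => u.1 = t) (fun v => v.2)
      ⟨v, Finset.mem_filter.2 ⟨hv, hvt⟩⟩
    rw [Finset.mem_filter] at hu
    refine Finset.mem_image.2 ⟨(u, (0, 1)), Finset.mem_filter.2 ⟨mem_bd.2 ⟨hu.1, by simp [mem_dirs], ?_⟩,
      rfl⟩, hu.2⟩
    intro hcon
    have := hmax _ (Finset.mem_filter.2 ⟨hcon, by simpa using hu.2⟩)
    simp at this
  have h1 := (Finset.card_le_card hsub).trans Finset.card_image_le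
  rw [Int.card_Icc] at h1
  omega

theorem diam_aux2 (A : Finset Site) (hA : connectedIn (↑A : Set Site)) (y z : Site) (hy : y ∈ A)
    (hz : z ∈ A) (hyz : y.2 ≤ z.2) :
    z.2 - y.2 ≤ (((bd A).filter fun p => p.2 = (1, 0)).card : ℤ) := by
  have hsub : Finset.Icc y.2 z.2 ⊆ ((bd A).filter fun p => p.2 = (1, 0)).image fun p => p.1.2 := by
    intro t ht
    rw [Finset.mem_Icc] at ht
    have hex : ∃ v ∈ A, v.2 = t := by
      rcases eq_or_lt_of_le ht.1 with h | h
      · exact ⟨y, hy, h⟩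
      · obtain ⟨a, b, ha, hb, hab, h1, h2⟩ := conn_exit hA (fun v => v.2 < t)
          (by simpa using hy) (by simpa using hz) h (by omega)
        refine ⟨b, by simpa using hb, ?_⟩
        unfold adjS at hab
        rw [mem_dirs] at hab
        simp only [Prod.ext_iff, Prod.fst_sub, Prod.snd_sub] at hab
        omega
    obtain ⟨v, hv, hvt⟩ := hex
    obtain ⟨u, hu, hmax⟩ := Finset.exists_max_image (A.filter fun u => u.2 = t) (fun v => v.1)
      ⟨v, Finset.mem_filter.2 ⟨hv, hvt⟩⟩
    rw [Finset.mem_filter] at hu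
    refine Finset.mem_image.2 ⟨(u, (1, 0)), Finset.mem_filter.2 ⟨mem_bd.2 ⟨hu.1, by simp [mem_dirs], ?_⟩,
      rfl⟩, hu.2⟩
    intro hcon
    have := hmax _ (Finset.mem_filter.2 ⟨hcon, by simpa using hu.2⟩)
    simp at this
  have h1 := (Finset.card_le_card hsub).trans Finset.card_image_le
  rw [Int.card_Icc] at h1
  omega

/-- ℓ¹ distance -/
def d1 (y z : Site) : ℤ := |y.1 - z.1| + |y.2 - z.2|

theorem d1_nonneg (y z : Site) : 0 ≤ d1 y z := by unfold d1; positivity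

theorem diam_le (A : Finset Site) (hA : connectedIn (↑A : Set Site)) (y z : Site) (hy : y ∈ A)
    (hz : z ∈ A) : d1 y z ≤ (edgeBdryCard A : ℤ) := by
  have h1 : |y.1 - z.1| ≤ (((bd A).filter fun p => p.2 = (0, 1)).card : ℤ) := by
    rcases le_total y.1 z.1 with h | h
    · have := diam_aux1 A hA y z hy hz h
      rw [abs_le]; omega
    · have := diam_aux1 A hA z y hz hy h
      rw [abs_le]; omega
  have h2 : |y.2 - z.2| ≤ (((bd A).filter fun p => p.2 = (1, 0)).card : ℤ) := by
    rcases le_total y.2 z.2 with h | h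
    · have := diam_aux2 A hA y z hy hz h
      rw [abs_le]; omega
    · have := diam_aux2 A hA z y hz hy h
      rw [abs_le]; omega
  have h3 : ((bd A).filter fun p => p.2 = (0, 1)).card + ((bd A).filter fun p => p.2 = (1, 0)).card
      ≤ edgeBdryCard A := by
    rw [← card_bd, ← Finset.card_union_of_disjoint]
    · exact Finset.card_le_card (Finset.union_subset (Finset.filter_subset _ _)
        (Finset.filter_subset _ _))
    · rw [Finset.disjoint_left]
      intro p hp hp'
      rw [Finset.mem_filter] at hp hp'
      rw [hp.2] at hp'
      simp at hp'
  unfold d1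
  omega

/-- Crossing sets have nearby boundaries. -/
theorem cross_near (A B : Finset Site) (hA : connectedIn (↑A : Set Site))
    (hAc : connectedIn ((↑A : Set Site)ᶜ)) (hB : connectedIn (↑B : Set Site))
    (hBc : connectedIn ((↑B : Set Site)ᶜ))
    (h1 : ¬ A ⊆ B) (h2 : ¬ B ⊆ A) (h3 : ¬ Disjoint A B) :
    ∃ p ∈ bd A, ∃ q ∈ bd B, nearS p.1 q.1 := by
  by_contra hcon
  push Not at hcon
  obtain ⟨a, haA, haB⟩ := Finset.not_subset.1 h1
  obtain ⟨b, hbB, hbA⟩ := Finset.not_subset.1 h2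
  obtain ⟨c, hcA, hcB⟩ := Finset.not_disjoint_iff.1 h3
  -- a point outside both
  obtain ⟨o, ho⟩ := Infinite.exists_notMem_finset (A ∪ B)
  rw [Finset.mem_union, not_or] at ho
  -- a dart of B inside A
  obtain ⟨u, v, hu, hv, huv, p1, p2⟩ := conn_exit hA (fun w => w ∈ B) (x := c) (y := a)
    (by simpa using hcA) (by simpa using haA) hcB haB
  obtain ⟨u', v', hu', hv', huv', p1', p2'⟩ := conn_exit hAc (fun w => w ∈ B) (x := b) (y := o)
    (by simpa using hbA) (by simpa using ho.1) hbB ho.2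
  have d1 : (u, v - u) ∈ bd B := mem_bd.2 ⟨p1, huv, by simpa using p2⟩
  have d2 : (u', v' - u') ∈ bd B := mem_bd.2 ⟨p1', huv', by simpa using p2'⟩
  have key := bd_conn B hB hBc ((bd B).filter fun p => p.1 ∈ A) (Finset.filter_subset _ _)
    (u, v - u) (Finset.mem_filter.2 ⟨d1, by simpa using hu⟩) (by
      intro p hp q hq hnear
      rw [Finset.mem_filter] at hp ⊢
      refine ⟨hq, ?_⟩
      by_contra hqA
      -- intermediate point
      have hx : ∀ w : Site, w ∈ A → ∀ d ∈ dirs, nearS w p.1 → w + d ∈ A := by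
        intro w hw d hd hn
        by_contra hwd
        exact hcon (w, d) (mem_bd.2 ⟨hw, hd, hwd⟩) p hp.1 hn
      apply hqA
      obtain ⟨⟨x, y⟩, d⟩ := p
      obtain ⟨⟨x', y'⟩, d'⟩ := q
      simp only [nearS] at hnear hx
      simp only at hp ⊢
      have hpA := hp.2
      rw [abs_le, abs_le] at hnear
      have m1 : (x', y) ∈ A := by
        have : x' = x ∨ x' = x + 1 ∨ x' = x + -1 := by omega
        rcases this with h | h | h
        · rw [h]; exact hpA
        · have := hx (x, y) hpA (1, 0) (by simp [mem_dirs]) (by simp)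
          rw [h]; simpa using this
        · have := hx (x, y) hpA (-1, 0) (by simp [mem_dirs]) (by simp)
          rw [h]; simpa using this
      have hn : |x' - x| ≤ 1 ∧ |y - y| ≤ 1 := by rw [abs_le, abs_le]; omega
      have : y' = y ∨ y' = y + 1 ∨ y' = y + -1 := by omega
      rcases this with h | h | h
      · rw [h]; exact m1
      · have := hx (x', y) m1 (0, 1) (by simp [mem_dirs]) hn
        rw [h]; simpa using this
      · have := hx (x', y) m1 (0, -1) (by simp [mem_dirs]) hn
        rw [h]; simpa using this)
  rw [← key] at d2
  exact hu' (by simpa using (Finset.mem_filter.1 d2).2)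

theorem share_near (A B : Finset Site) (h : shareEdge A B) :
    ∃ p ∈ bd A, ∃ q ∈ bd B, nearS p.1 q.1 := by
  obtain ⟨v, d, hd, ⟨h1, h2⟩, h3 | h3⟩ := h
  · exact ⟨(v, d), mem_bd.2 ⟨h1, hd, h2⟩, (v, d), mem_bd.2 ⟨h3.1, hd, h3.2⟩, by simp [nearS]⟩
  · refine ⟨(v, d), mem_bd.2 ⟨h1, hd, h2⟩, (v + d, -d), mem_bd.2 ⟨h3.1, neg_mem_dirs hd,
      by simpa using h3.2⟩, ?_⟩
    rw [mem_dirs] at hd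
    rcases hd with h | h | h | h <;> subst h <;> simp [nearS]

theorem incompat_near (γ γ' : Contour) (h : γ.valid) (h' : γ'.valid) (hc : ¬ compatPair γ γ') :
    ∃ p ∈ bd γ.int, ∃ q ∈ bd γ'.int, nearS p.1 q.1 := by
  by_cases hs : shareEdge γ.int γ'.int
  · exact share_near _ _ hs
  · have : ¬ (γ.int ⊆ γ'.int ∨ γ'.int ⊆ γ.int ∨ Disjoint γ.int γ'.int) := by
      intro hh
      exact hc ⟨hh, fun h => absurd h hs⟩
    push Not at this
    exact cross_near _ _ h.2.1 h.2.2 h'.2.1 h'.2.2 this.1 this.2.1 this.2.2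

theorem compat_refl (γ : Contour) (h : γ.int.Nonempty) : compatPair γ γ := by
  refine ⟨Or.inl (Finset.Subset.refl _), fun _ => ⟨fun _ => rfl, fun hd => ?_⟩⟩
  rw [disjoint_self] at hd
  exact absurd hd h.ne_empty

theorem inc_near (γ γ' : Contour) (h : γ.valid) (h' : γ'.valid) (hc : inc compatPair γ γ') :
    ∃ p ∈ bd γ.int, ∃ q ∈ bd γ'.int, nearS p.1 q.1 := by
  unfold inc at hc
  rw [not_and_or] at hc
  rcases hc with hc | hc
  · exact incompat_near γ γ' h h' hc
  · obtain ⟨p, hp, q, hq, hn⟩ := incompat_near γ' γ h' h hc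
    exact ⟨q, hq, p, hp, nearS_symm hn⟩

/-- Contour counting. -/
theorem contour_count (e : Site × Site) (n : ℕ) (T : Finset Contour)
    (hT : ∀ γ ∈ T, γ.valid ∧ e ∈ bd γ.int ∧ γ.len = n) : T.card ≤ 2 * 36 ^ (2 * n) := by
  have h1 : (T.image fun γ => bd γ.int).card ≤ 36 ^ (2 * n - 2) := by
    apply animal_count nbD 36 card_nbD ?_ e n
    · intro S hS
      obtain ⟨γ, hγ, rfl⟩ := Finset.mem_image.1 hS
      obtain ⟨hv, he, hl⟩ := hT γ hγ
      refine ⟨he, by rw [card_bd]; exact hl, ?_⟩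
      intro E1 hE1 heE hcl
      refine bd_conn γ.int hv.2.1 hv.2.2 E1 hE1 e heE ?_
      intro a ha b hb hn
      exact hcl a ha b hb (mem_nbD.2 ⟨hn, (mem_bd.1 hb).2.1, (mem_bd.1 (hE1 ha)).2.1⟩)
    · intro a b hab
      obtain ⟨h1, h2, h3⟩ := mem_nbD.1 hab
      exact mem_nbD.2 ⟨nearS_symm h1, h3, h2⟩
  have h2 : T.card ≤ ((T.image fun γ => bd γ.int) ×ˢ (Finset.univ : Finset Bool)).card := by
    apply Finset.card_le_card_of_injOn (fun γ => (bd γ.int, γ.up))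
    · intro γ hγ
      simp only [Finset.coe_product, Set.mem_prod, Finset.mem_coe, Finset.mem_image]
      exact ⟨⟨γ, hγ, rfl⟩, by simp⟩
    · rintro ⟨A, u⟩ hγ ⟨B, u'⟩ hγ' heq
      simp only [Prod.mk.injEq] at heq
      have hv := (hT _ hγ).1
      have hv' := (hT _ hγ').1
      have := bd_inj A B hv.2.1 hv'.2.1 (bd_nonempty A hv.1) heq.1
      rw [this, heq.2]
  rw [Finset.card_product] at h2
  have h3 : (36 : ℕ) ^ (2 * n - 2) ≤ 36 ^ (2 * n) := Nat.pow_le_pow_right (by norm_num) (by omega)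
  simp at h2
  nlinarith
end PartC

section PartD
attribute [local instance] Classical.propDecidable

theorem exp_four : (36 : ℝ) ≤ Real.exp 4 := by
  have h := Real.exp_one_gt_d9
  have h2 : Real.exp 4 = Real.exp 1 ^ 4 := by rw [← Real.exp_nat_mul]; norm_num
  rw [h2]
  have : (2.7 : ℝ) ^ 4 ≤ Real.exp 1 ^ 4 := pow_le_pow_left₀ (by norm_num) (by linarith) 4
  refine le_trans ?_ this
  norm_num

theorem exp_neg_half {x : ℝ} (hx : 1 ≤ x) : Real.exp (-x) ≤ 1 / 2 := by
  have h := Real.exp_one_gt_d9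
  have : Real.exp (-x) ≤ Real.exp (-1) := Real.exp_le_exp.2 (by linarith)
  refine this.trans ?_
  rw [Real.exp_neg, inv_le_comm₀ (by positivity) (by norm_num)]
  linarith

theorem geom_sum_aux (r : ℝ) (h0 : 0 ≤ r) (h1 : r ≤ 1 / 2) (F : Finset ℕ) (hF : ∀ n ∈ F, 1 ≤ n) :
    ∑ n ∈ F, r ^ n ≤ 2 * r := by
  have e1 : ∑ n ∈ F, r ^ n = r * ∑ n ∈ F, r ^ (n - 1) := by
    rw [Finset.mul_sum]
    apply Finset.sum_congr rfl
    intro n hn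
    rw [← pow_succ', Nat.sub_add_cancel (hF n hn)]
  have e2 : ∑ n ∈ F, r ^ (n - 1) = ∑ m ∈ F.image (fun n => n - 1), r ^ m := by
    rw [Finset.sum_image]
    intro a ha b hb hab
    have := hF a ha
    have := hF b hb
    simp only at hab
    omega
  have hs := hasSum_geometric_of_lt_one h0 (by linarith : r < 1)
  have h3 : ∑ m ∈ F.image (fun n => n - 1), r ^ m ≤ (1 - r)⁻¹ := by
    rw [← hs.tsum_eq]
    exact hs.summable.sum_le_tsum _ (fun i _ => pow_nonneg h0 i)
  have h4 : (1 - r)⁻¹ ≤ 2 := by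
    rw [inv_le_comm₀ (by linarith) (by norm_num)]
    linarith
  rw [e1, e2]
  nlinarith

theorem len_pos (γ : Contour) (h : γ.valid) : 1 ≤ γ.len := by
  unfold Contour.len
  rw [← card_bd]
  exact Finset.card_pos.2 (bd_nonempty _ h.1)

theorem peierls_sum (b : ℝ) (hb : 20 ≤ b) (e : Site × Site) (T : Finset Contour)
    (hT : ∀ γ ∈ T, γ.valid ∧ e ∈ bd γ.int) :
    ∑ γ ∈ T, Real.exp (-b * γ.len) ≤ 4 * Real.exp (-(b - 8)) := by
  have h1 : ∑ γ ∈ T, Real.exp (-b * γ.len) =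
      ∑ n ∈ T.image Contour.len, ∑ γ ∈ T.filter (fun γ => γ.len = n), Real.exp (-b * γ.len) :=
    (Finset.sum_fiberwise_of_maps_to (fun γ hγ => Finset.mem_image_of_mem _ hγ) _).symm
  rw [h1]
  have h2 : ∀ n ∈ T.image Contour.len,
      ∑ γ ∈ T.filter (fun γ => γ.len = n), Real.exp (-b * γ.len) ≤
        2 * (Real.exp (-(b - 8))) ^ n := by
    intro n _
    have e1 : ∑ γ ∈ T.filter (fun γ => γ.len = n), Real.exp (-b * γ.len) =
        ((T.filter (fun γ => γ.len = n)).card : ℝ) * Real.exp (-b * n) := by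
      rw [← nsmul_eq_mul, ← Finset.sum_const]
      apply Finset.sum_congr rfl
      intro γ hγ
      rw [(Finset.mem_filter.1 hγ).2]
    have hc := contour_count e n (T.filter (fun γ => γ.len = n)) (by
      intro γ hγ
      rw [Finset.mem_filter] at hγ
      exact ⟨(hT γ hγ.1).1, (hT γ hγ.1).2, hγ.2⟩)
    have hc' : ((T.filter (fun γ => γ.len = n)).card : ℝ) ≤ 2 * 36 ^ (2 * n) := by
      exact_mod_cast hc
    have h36 : (36 : ℝ) ^ (2 * n) ≤ Real.exp (8 * n) := by
      have : Real.exp (8 * n) = Real.exp 4 ^ (2 * n) := by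
        rw [← Real.exp_nat_mul]; push_cast; ring_nf
      rw [this]
      exact pow_le_pow_left₀ (by norm_num) exp_four _
    rw [e1]
    have e3 : (Real.exp (-(b - 8))) ^ n = Real.exp (8 * n) * Real.exp (-b * n) := by
      rw [← Real.exp_nat_mul, ← Real.exp_add]; ring_nf
    rw [e3, ← mul_assoc]
    apply mul_le_mul_of_nonneg_right _ (Real.exp_pos _).le
    linarith
  refine (Finset.sum_le_sum h2).trans ?_
  rw [← Finset.mul_sum]
  have := geom_sum_aux (Real.exp (-(b - 8))) (Real.exp_pos _).le (exp_neg_half (by linarith))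
    (T.image Contour.len) (by
      intro n hn
      obtain ⟨γ, hγ, rfl⟩ := Finset.mem_image.1 hn
      exact len_pos γ (hT γ hγ).1)
  linarith

theorem Zsos_nonneg (β lam : ℝ) (η : Site → BSign) (h : ℤ) (V : Finset Site) :
    0 ≤ Zsos β lam η h V := by
  unfold Zsos
  apply tsum_nonneg
  intro ψ
  apply Set.indicator_apply_nonneg
  intro _
  exact (Real.exp_pos _).le

theorem Wtr_nonneg (β lam : ℝ) (h : ℤ) (γ : Contour) : 0 ≤ Wtr β lam h γ := by
  unfold Wtr
  refine le_min ?_ (Real.exp_pos _).le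
  unfold Wrn
  split_ifs
  · exact mul_nonneg (Real.exp_pos _).le (div_nonneg (Zsos_nonneg ..) (Zsos_nonneg ..))
  · exact mul_nonneg (Real.exp_pos _).le (div_nonneg (Zsos_nonneg ..) (Zsos_nonneg ..))

theorem Wtr_le (β lam : ℝ) (h : ℤ) (γ : Contour) :
    Wtr β lam h γ ≤ Real.exp (-(β - 5) * (γ.len : ℝ)) := min_le_right _ _

theorem Wtr_half (β lam : ℝ) (hβ : 100 < β) (h : ℤ) (γ : Contour) (hv : γ.valid) :
    Wtr β lam h γ ≤ 1 / 2 := by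
  refine (Wtr_le β lam h γ).trans ?_
  rw [neg_mul]
  apply exp_neg_half
  have : (1 : ℝ) ≤ γ.len := by exact_mod_cast len_pos γ hv
  nlinarith

noncomputable def wt (β lam : ℝ) (h : ℤ) (γ : Contour) : ℝ := Wtr β lam h γ / (1 - Wtr β lam h γ)

theorem wt_nonneg (β lam : ℝ) (hβ : 100 < β) (h : ℤ) (γ : Contour) (hv : γ.valid) :
    0 ≤ wt β lam h γ :=
  div_nonneg (Wtr_nonneg _ _ _ _) (by linarith [Wtr_half β lam hβ h γ hv])

theorem wt_le (β lam : ℝ) (hβ : 100 < β) (h : ℤ) (γ : Contour) (hv : γ.valid) :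
    wt β lam h γ ≤ 2 * Real.exp (-(β - 5) * (γ.len : ℝ)) := by
  have h1 := Wtr_half β lam hβ h γ hv
  have h2 := Wtr_le β lam h γ
  have h3 := Wtr_nonneg β lam h γ
  unfold wt
  rw [div_le_iff₀ (by linarith)]
  nlinarith [Real.exp_pos (-(β - 5) * (γ.len : ℝ))]

/-- furthest distance from `x` reached by the contour. -/
noncomputable def reach (x : Site) (γ : Contour) : ℕ := γ.int.sup fun y => (d1 x y).toNat

theorem le_reach (x : Site) (γ : Contour) (y : Site) (hy : y ∈ γ.int) :
    d1 x y ≤ reach x γ := by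
  have := Finset.le_sup (f := fun y => (d1 x y).toNat) hy
  have h2 := d1_nonneg x y
  unfold reach
  omega

theorem d1_triangle (x y z : Site) : d1 x z ≤ d1 x y + d1 y z := by
  unfold d1
  have := abs_sub_le x.1 y.1 z.1
  have := abs_sub_le x.2 y.2 z.2
  omega

theorem reach_le (x : Site) (γ : Contour) (hv : γ.valid) (y : Site) (hy : y ∈ γ.int) :
    (reach x γ : ℤ) ≤ d1 x y + γ.len := by
  have : reach x γ ≤ (d1 x y + γ.len).toNat := by
    unfold reach
    apply Finset.sup_le
    intro z hz
    have h1 := d1_triangle x y z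
    have h2 := diam_le γ.int hv.2.1 y z hy hz
    unfold Contour.len
    omega
  have := d1_nonneg x y
  omega

noncomputable def gfun (β lam : ℝ) (h : ℤ) (x : Site) (R : ℕ) (γ : Contour) : ℝ :=
  wt β lam h γ * (Real.exp γ.len * Real.exp (reach x γ) * Real.exp (-R))

theorem gfun_nonneg (β lam : ℝ) (hβ : 100 < β) (h : ℤ) (x : Site) (R : ℕ) (γ : Contour)
    (hv : γ.valid) : 0 ≤ gfun β lam h x R γ := by
  have := wt_nonneg β lam hβ h γ hv
  unfold gfun
  positivity

theorem gfun_le (β lam : ℝ) (hβ : 100 < β) (h : ℤ) (x : Site) (R : ℕ) (γ : Contour)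
    (hv : γ.valid) (m : ℝ) (hm : (reach x γ : ℝ) ≤ m + γ.len) :
    gfun β lam h x R γ ≤ 2 * Real.exp m * Real.exp (-R) * Real.exp (-(β - 7) * γ.len) := by
  have h1 := wt_le β lam hβ h γ hv
  unfold gfun
  refine (mul_le_mul_of_nonneg_right h1 (by positivity)).trans ?_
  have h2 : Real.exp (reach x γ) ≤ Real.exp m * Real.exp γ.len := by
    rw [← Real.exp_add]; exact Real.exp_le_exp.2 hm
  have h3 : Real.exp (-(β - 7) * γ.len) =
      Real.exp (-(β - 5) * γ.len) * Real.exp γ.len * Real.exp γ.len := by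
    rw [← Real.exp_add, ← Real.exp_add]; ring_nf
  rw [h3]
  calc _ ≤ 2 * Real.exp (-(β - 5) * γ.len) * (Real.exp γ.len * (Real.exp m * Real.exp γ.len) *
        Real.exp (-R)) := by gcongr
    _ = _ := by ring

theorem exp_small : 288 * Real.exp 2 * Real.exp (-(85 : ℝ)) ≤ 1 := by
  have h : (288 : ℝ) ≤ Real.exp 8 := by
    have h2 : Real.exp 8 = Real.exp 4 * Real.exp 4 := by rw [← Real.exp_add]; norm_num
    rw [h2]; nlinarith [exp_four]
  calc _ ≤ Real.exp 8 * Real.exp 2 * Real.exp (-(85 : ℝ)) := by gcongr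
    _ = Real.exp (-75) := by rw [← Real.exp_add, ← Real.exp_add]; norm_num
    _ ≤ 1 := Real.exp_le_one_iff.2 (by norm_num)

/-- The Kotecky-Preiss type condition. -/
theorem kp_sum (β lam : ℝ) (hβ : 100 < β) (h : ℤ) (x : Site) (R : ℕ) (γ : Contour)
    (hv : γ.valid) (T : Finset Contour) (hT : ∀ γ' ∈ T, γ'.valid ∧ inc compatPair γ γ') :
    wt β lam h γ * ∑ γ' ∈ T, gfun β lam h x R γ' ≤ gfun β lam h x R γ := by
  unfold gfun
  apply mul_le_mul_of_nonneg_left _ (wt_nonneg β lam hβ h γ hv)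
  change ∑ γ' ∈ T, gfun β lam h x R γ' ≤ _
  set N := (bd γ.int).biUnion nbD with hN
  set K := 2 * Real.exp (reach x γ + 2) * Real.exp (-(R : ℝ)) with hK
  have hKpos : 0 < K := by positivity
  have hnear : ∀ γ' ∈ T, ∃ q ∈ N, q ∈ bd γ'.int ∧
      gfun β lam h x R γ' ≤ K * Real.exp (-(β - 7) * γ'.len) := by
    intro γ' hγ'
    obtain ⟨hv', hinc⟩ := hT γ' hγ'
    obtain ⟨p, hp, q, hq, hn⟩ := inc_near γ γ' hv hv' hinc
    refine ⟨q, Finset.mem_biUnion.2 ⟨p, hp, mem_nbD.2 ⟨hn, (mem_bd.1 hq).2.1, (mem_bd.1 hp).2.1⟩⟩, hq, ?_⟩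
    apply gfun_le β lam hβ h x R γ' hv'
    have h1 := reach_le x γ' hv' q.1 (mem_bd.1 hq).1
    have h2 := le_reach x γ p.1 (mem_bd.1 hp).1
    have h3 := d1_triangle x p.1 q.1
    have h4 : d1 p.1 q.1 ≤ 2 := by
      unfold nearS at hn
      unfold d1
      omega
    have h5 : (reach x γ' : ℤ) ≤ reach x γ + 2 + γ'.len := by omega
    exact_mod_cast h5
  have s1 : ∑ γ' ∈ T, gfun β lam h x R γ' ≤
      ∑ q ∈ N, ∑ γ' ∈ T.filter (fun γ' => q ∈ bd γ'.int), K * Real.exp (-(β - 7) * γ'.len) := by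
    have : ∀ γ' ∈ T, gfun β lam h x R γ' ≤ ∑ q ∈ N, if q ∈ bd γ'.int then
        K * Real.exp (-(β - 7) * γ'.len) else 0 := by
      intro γ' hγ'
      obtain ⟨q, hqN, hq, hle⟩ := hnear γ' hγ'
      refine hle.trans ?_
      have := Finset.single_le_sum (f := fun q => if q ∈ bd γ'.int then
        K * Real.exp (-(β - 7) * γ'.len) else 0) (fun q _ => by split_ifs <;> positivity) hqN
      simpa [hq] using this
    refine (Finset.sum_le_sum this).trans ?_
    rw [Finset.sum_comm]
    apply le_of_eq
    apply Finset.sum_congr rfl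
    intro q _
    rw [Finset.sum_filter]
  refine s1.trans ?_
  have s2 : ∀ q ∈ N, ∑ γ' ∈ T.filter (fun γ' => q ∈ bd γ'.int), K * Real.exp (-(β - 7) * γ'.len) ≤
      K * (4 * Real.exp (-85)) := by
    intro q _
    rw [← Finset.mul_sum]
    apply mul_le_mul_of_nonneg_left _ hKpos.le
    refine (peierls_sum (β - 7) (by linarith) q _ ?_).trans ?_
    · intro γ' hγ'
      rw [Finset.mem_filter] at hγ'
      exact ⟨(hT γ' hγ'.1).1, hγ'.2⟩
    · have : Real.exp (-(β - 7 - 8)) ≤ Real.exp (-85) := Real.exp_le_exp.2 (by linarith)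
      linarith
  refine (Finset.sum_le_sum s2).trans ?_
  rw [Finset.sum_const, nsmul_eq_mul]
  have hcard : (N.card : ℝ) ≤ γ.len * 36 := by
    have : N.card ≤ γ.len * 36 := by
      unfold Contour.len
      rw [← card_bd]
      exact Finset.card_biUnion_le_card_mul _ _ _ fun p _ => card_nbD p
    exact_mod_cast this
  have hl : (γ.len : ℝ) ≤ Real.exp γ.len := by
    linarith [Real.add_one_le_exp (γ.len : ℝ)]
  calc (N.card : ℝ) * (K * (4 * Real.exp (-85)))
      ≤ (γ.len * 36) * (K * (4 * Real.exp (-85))) := by gcongr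
    _ = γ.len * (Real.exp (reach x γ) * Real.exp (-R)) * (288 * Real.exp 2 * Real.exp (-85)) := by
        rw [hK, Real.exp_add]; ring
    _ ≤ γ.len * (Real.exp (reach x γ) * Real.exp (-R)) * 1 := by
        apply mul_le_mul_of_nonneg_left exp_small; positivity
    _ ≤ Real.exp γ.len * (Real.exp (reach x γ) * Real.exp (-R)) * 1 := by gcongr
    _ = _ := by ring

/-! ### Families -/

def CC (γ γ' : Contour) : Prop := γ = γ' ∨ compatPair γ γ'

theorem CC_refl (γ : Contour) : CC γ γ := Or.inl rfl

theorem inc_of_CC (γ γ' : Contour) (h : inc CC γ γ') : inc compatPair γ γ' := by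
  unfold inc CC at *
  tauto

def allow (η : Site → BSign) (h : ℤ) (U : Finset Site) (γ : Contour) : Prop :=
  γ.valid ∧ γ.int ⊆ U ∧ (∀ v ∈ innerBdry U, v ∈ γ.int →
    (γ.up = true → η v ≠ BSign.minus ∧ η v ≠ BSign.zero) ∧
    (γ.up = false → η v ≠ BSign.plus ∧ η v ≠ BSign.zero)) ∧
  (h = 0 → γ.up = true)

noncomputable def fam (η : Site → BSign) (h : ℤ) (U V : Finset Site) : Finset Contour :=
  ((V.powerset ×ˢ (Finset.univ : Finset Bool)).image fun p => (⟨p.1, p.2⟩ : Contour)).filter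
    (allow η h U)

theorem mem_fam {η : Site → BSign} {h : ℤ} {U V : Finset Site} {γ : Contour} :
    γ ∈ fam η h U V ↔ γ.int ⊆ V ∧ allow η h U γ := by
  unfold fam
  rw [Finset.mem_filter, Finset.mem_image]
  constructor
  · rintro ⟨⟨p, hp, rfl⟩, h2⟩
    simp at hp
    exact ⟨hp, h2⟩
  · rintro ⟨h1, h2⟩
    exact ⟨⟨(γ.int, γ.up), by simpa using h1, rfl⟩, h2⟩

theorem Ztr_eq (β lam : ℝ) (η : Site → BSign) (h : ℤ) (U : Finset Site) :
    Ztr β lam η h U = Real.exp (-lam * (h : ℝ) * (U.card : ℝ)) *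
      polyZ CC (Wtr β lam h) (fam η h U U) := by
  unfold Ztr polyZ
  congr 1
  apply tsum_congr
  intro Γ
  have : (Γ ∈ {Γ | famOK η h U Γ}) = (Γ ∈ {Γ : Multiset Contour | (∀ γ ∈ Γ, γ ∈ fam η h U U) ∧
      ∀ γ ∈ Γ, ∀ γ' ∈ Γ, CC γ γ'}) := by
    apply propext
    simp only [Set.mem_ofPred_eq, mem_fam]
    unfold famOK allow
    constructor
    · rintro ⟨h1, h2, h3, h4⟩
      exact ⟨fun γ hγ => ⟨(h1 γ hγ).2, (h1 γ hγ).1, (h1 γ hγ).2, fun v hv hvi => h3 v hv γ hγ hvi,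
        fun h => h4 h γ hγ⟩, fun γ hγ γ' hγ' => Or.inr (h2 γ hγ γ' hγ')⟩
    · rintro ⟨h1, h2⟩
      refine ⟨fun γ hγ => ⟨(h1 γ hγ).2.1, (h1 γ hγ).1⟩, ?_, fun v hv γ hγ hvi => (h1 γ hγ).2.2.2.1 v hv hvi,
        fun h γ hγ => (h1 γ hγ).2.2.2.2 h⟩
      intro γ hγ γ' hγ'
      rcases h2 γ hγ γ' hγ' with he | hc
      · subst he; exact compat_refl γ (h1 γ hγ).2.1.1
      · exact hc
  unfold polyF
  by_cases hm : Γ ∈ {Γ | famOK η h U Γ}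
  · rw [Set.indicator_of_mem hm, Set.indicator_of_mem (this ▸ hm)]
    rfl
  · rw [Set.indicator_of_notMem hm, Set.indicator_of_notMem (this ▸ hm)]

/-- local contribution of the site `x`. -/
noncomputable def locT (β lam : ℝ) (η : Site → BSign) (h : ℤ) (U : Finset Site) (x : Site) : ℝ :=
  Real.log (polyZ CC (Wtr β lam h) (fam η h U (U.filter fun y => toLex y ≤ toLex x))) -
  Real.log (polyZ CC (Wtr β lam h) (fam η h U (U.filter fun y => toLex y < toLex x)))

theorem fam_filter (η : Site → BSign) (h : ℤ) (U : Finset Site) (x : Site)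
    [DecidablePred (· ∉ {γ : Contour | x ∈ γ.int})] :
    (fam η h U (U.filter fun y => toLex y ≤ toLex x)).filter (· ∉ {γ : Contour | x ∈ γ.int}) =
      fam η h U (U.filter fun y => toLex y < toLex x) := by
  ext γ
  simp only [Finset.mem_filter, mem_fam, Set.mem_ofPred_eq]
  constructor
  · rintro ⟨⟨h1, h2⟩, h3⟩
    refine ⟨?_, h2⟩
    intro y hy
    have := Finset.mem_filter.1 (h1 hy)
    refine Finset.mem_filter.2 ⟨this.1, lt_of_le_of_ne this.2 ?_⟩
    intro he
    have : y = x := toLex.injective he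
    exact h3 (this ▸ hy)
  · rintro ⟨h1, h2⟩
    refine ⟨⟨?_, h2⟩, ?_⟩
    · intro y hy
      have := Finset.mem_filter.1 (h1 hy)
      exact Finset.mem_filter.2 ⟨this.1, this.2.le⟩
    · intro hx
      exact absurd (Finset.mem_filter.1 (h1 hx)).2 (lt_irrefl _)

theorem telescope {α : Type*} [LinearOrder α] (G : Finset α → ℝ) (U : Finset α) :
    ∑ x ∈ U, (G (U.filter fun y => y ≤ x) - G (U.filter fun y => y < x)) = G U - G ∅ := by
  induction U using Finset.induction_on_max with
  | empty => simp
  | insert a s ha ih =>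
    have hna : a ∉ s := fun h => lt_irrefl _ (ha a h)
    rw [Finset.sum_insert hna]
    have e1 : (insert a s).filter (fun y => y ≤ a) = insert a s := by
      apply Finset.filter_true_of_mem
      intro y hy
      rcases Finset.mem_insert.1 hy with h | h
      · exact h.le
      · exact (ha y h).le
    have e2 : (insert a s).filter (fun y => y < a) = s := by
      ext y
      simp only [Finset.mem_filter, Finset.mem_insert]
      constructor
      · rintro ⟨h | h, h'⟩
        · exact absurd h' (h ▸ lt_irrefl _)
        · exact h
      · intro h; exact ⟨Or.inr h, ha y h⟩
    have e3 : ∑ x ∈ s, (G ((insert a s).filter fun y => y ≤ x) -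
        G ((insert a s).filter fun y => y < x)) =
        ∑ x ∈ s, (G (s.filter fun y => y ≤ x) - G (s.filter fun y => y < x)) := by
      apply Finset.sum_congr rfl
      intro x hx
      rw [Finset.filter_insert, Finset.filter_insert, if_neg (not_le.2 (ha x hx)),
        if_neg (not_lt.2 (ha x hx).le)]
    rw [e1, e2, e3, ih]
    ring

theorem logZ_sum (β lam : ℝ) (η : Site → BSign) (h : ℤ) (U : Finset Site) :
    Real.log (polyZ CC (Wtr β lam h) (fam η h U U)) = ∑ x ∈ U, locT β lam η h U x := by
  have hT := telescope (α := Lex Site)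
    (fun V => Real.log (polyZ CC (Wtr β lam h) (fam η h U (V.map ofLex.toEmbedding))))
    (U.map toLex.toEmbedding)
  rw [Finset.sum_map] at hT
  have e0 : fam η h U ∅ = ∅ := by
    ext γ
    rw [mem_fam]
    simp only [Finset.subset_empty, Finset.notMem_empty, iff_false]
    rintro ⟨h1, h2⟩
    exact h2.1.1.ne_empty h1
  have e1 : polyZ CC (Wtr β lam h) ∅ = 1 := by
    unfold polyZ
    rw [tsum_eq_single 0]
    · rw [polyF_of] <;> simp
    · intro Γ hΓ
      by_contra hne
      apply hΓ
      have := (polyF_ne _ _ _ Γ hne).1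
      exact Multiset.eq_zero_of_forall_notMem (fun a ha => by simpa using this a ha)
  have e2 : (U.map toLex.toEmbedding).map ofLex.toEmbedding = U := by
    ext y; simp
  simp only [Finset.map_empty, e0, e1, Real.log_one, sub_zero, e2] at hT
  rw [← hT]
  apply Finset.sum_congr rfl
  intro x _
  unfold locT
  have e3 : ((U.map toLex.toEmbedding).filter fun y => y ≤ toLex x).map ofLex.toEmbedding =
      U.filter fun y => toLex y ≤ toLex x := by
    ext y; simp
  have e4 : ((U.map toLex.toEmbedding).filter fun y => y < toLex x).map ofLex.toEmbedding =
      U.filter fun y => toLex y < toLex x := by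
    ext y; simp
  rw [← e3, ← e4]
  congr! 7

/-- Comparison of the local contributions. -/
theorem locT_compare (β lam : ℝ) (hβ : 100 < β) (h : ℤ) (η η' : Site → BSign) (U U' : Finset Site)
    (x : Site) (R : ℕ)
    (hU : ∀ y, d1 x y < R → y ∈ U ∧ y ∉ innerBdry U)
    (hU' : ∀ y, d1 x y < R → y ∈ U' ∧ y ∉ innerBdry U') :
    |locT β lam η h U x - locT β lam η' h U' x| ≤ 8 * Real.exp (-(β - 15)) * Real.exp (-R) := by
  set A := fam η h U (U.filter fun y => toLex y ≤ toLex x) with hA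
  set A' := fam η' h U' (U'.filter fun y => toLex y ≤ toLex x) with hA'
  have hval : ∀ γ ∈ A ∪ A', γ.valid := by
    intro γ hγ
    rcases Finset.mem_union.1 hγ with hγ | hγ
    · exact (mem_fam.1 hγ).2.1
    · exact (mem_fam.1 hγ).2.1
  have hlex : ∀ γ ∈ A ∪ A', ∀ y ∈ γ.int, toLex y ≤ toLex x := by
    intro γ hγ y hy
    rcases Finset.mem_union.1 hγ with hγ | hγ
    · exact (Finset.mem_filter.1 ((mem_fam.1 hγ).1 hy)).2
    · exact (Finset.mem_filter.1 ((mem_fam.1 hγ).1 hy)).2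
  have hdiff : ∀ (η₁ η₂ : Site → BSign) (U₁ U₂ : Finset Site),
      (∀ y, d1 x y < R → y ∈ U₂ ∧ y ∉ innerBdry U₂) →
      ∀ γ ∈ fam η₁ h U₁ (U₁.filter fun y => toLex y ≤ toLex x),
      γ ∉ fam η₂ h U₂ (U₂.filter fun y => toLex y ≤ toLex x) → R ≤ reach x γ := by
    intro η₁ η₂ U₁ U₂ hU₂ γ h1 h2
    by_contra hR
    apply h2
    obtain ⟨m1, m2⟩ := mem_fam.1 h1
    have hin : ∀ y ∈ γ.int, y ∈ U₂ ∧ y ∉ innerBdry U₂ := by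
      intro y hy
      apply hU₂
      have := le_reach x γ y hy
      omega
    refine mem_fam.2 ⟨?_, m2.1, fun y hy => (hin y hy).1, fun v hv hvi => absurd hv (hin v hvi).2,
      m2.2.2.2⟩
    intro y hy
    exact Finset.mem_filter.2 ⟨(hin y hy).1, (Finset.mem_filter.1 (m1 hy)).2⟩
  have main := poly_compare CC (Wtr β lam h) (gfun β lam h x R) CC_refl {γ | R ≤ reach x γ} _ A A' le_rfl
    (fun γ hγ => ⟨Wtr_nonneg _ _ _ _, by linarith [Wtr_half β lam hβ h γ (hval γ hγ)]⟩)
    (fun γ hγ => gfun_nonneg β lam hβ h x R γ (hval γ hγ))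
    (by
      intro γ hγ hD
      have hD' : R ≤ reach x γ := hD
      unfold gfun
      apply le_mul_of_one_le_right (wt_nonneg β lam hβ h γ (hval γ hγ))
      rw [← Real.exp_add, ← Real.exp_add]
      apply Real.one_le_exp
      have h1 : (R : ℝ) ≤ reach x γ := by exact_mod_cast hD'
      have h2 : (0 : ℝ) ≤ γ.len := by positivity
      linarith)
    (by
      intro γ hγ T hT hinc
      exact kp_sum β lam hβ h x R γ (hval γ hγ) T
        fun γ' hγ' => ⟨hval γ' (hT hγ'), inc_of_CC _ _ (hinc γ' hγ')⟩)
    (fun γ h1 h2 => hdiff η η' U U' hU' γ h1 h2)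
    (fun γ h1 h2 => hdiff η' η U' U hU γ h1 h2)
    {γ | x ∈ γ.int}
  rw [hA, hA', fam_filter, fam_filter] at main
  refine le_trans main ?_
  rw [← hA, ← hA']
  have hb : ∀ γ ∈ (A ∪ A').filter (· ∈ {γ : Contour | x ∈ γ.int}), gfun β lam h x R γ ≤
      2 * Real.exp 0 * Real.exp (-R) * Real.exp (-(β - 7) * γ.len) := by
    intro γ hγ
    obtain ⟨h1, h2⟩ := Finset.mem_filter.1 hγ
    apply gfun_le β lam hβ h x R γ (hval γ h1)
    have := reach_le x γ (hval γ h1) x h2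
    have h0 : d1 x x = 0 := by simp [d1]
    rw [h0] at this
    exact_mod_cast this
  refine le_trans (le_of_eq ?_) ((Finset.sum_le_sum hb).trans ?_)
  · congr!
  rw [← Finset.mul_sum]
  have hp := peierls_sum (β - 7) (by linarith) (x, (0, 1))
    ((A ∪ A').filter (· ∈ {γ : Contour | x ∈ γ.int})) (by
      intro γ hγ
      obtain ⟨h1, h2⟩ := Finset.mem_filter.1 hγ
      refine ⟨hval γ h1, mem_bd.2 ⟨h2, by simp [mem_dirs], ?_⟩⟩
      intro hcon
      have := hlex γ h1 _ hcon
      rw [Prod.Lex.toLex_le_toLex] at this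
      simp at this)
  calc _ ≤ 2 * Real.exp 0 * Real.exp (-R) * (4 * Real.exp (-(β - 7 - 8))) := by gcongr
    _ = _ := by rw [Real.exp_zero]; ring_nf
end PartD

section PartE
attribute [local instance] Classical.propDecidable

/-! ### Translation invariance -/

/-- translate of a finite set. -/
noncomputable def sh (t : Site) (A : Finset Site) : Finset Site :=
  A.map (Equiv.addRight t).toEmbedding

theorem mem_sh {t y : Site} {A : Finset Site} : y ∈ sh t A ↔ y - t ∈ A := by
  unfold sh
  rw [Finset.mem_map]
  constructor
  · rintro ⟨a, ha, rfl⟩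
    simpa using ha
  · intro h
    exact ⟨y - t, h, by simp⟩

theorem add_mem_sh {t y : Site} {A : Finset Site} : y + t ∈ sh t A ↔ y ∈ A := by
  rw [mem_sh, add_sub_cancel_right]

theorem add_mem_sh' {t y d : Site} {A : Finset Site} : y + t + d ∈ sh t A ↔ y + d ∈ A := by
  rw [mem_sh, add_right_comm, add_sub_cancel_right]

theorem sum_sh (t : Site) (A : Finset Site) (f : Site → ℝ) :
    ∑ v ∈ sh t A, f v = ∑ v ∈ A, f (v + t) := by
  unfold sh
  rw [Finset.sum_map]
  rfl

theorem edgeBdryCard_sh (t : Site) (A : Finset Site) : edgeBdryCard (sh t A) = edgeBdryCard A := by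
  unfold edgeBdryCard
  conv_lhs => unfold sh
  rw [Finset.sum_map]
  apply Finset.sum_congr rfl
  intro v _
  congr 1
  apply Finset.filter_congr
  intro d _
  exact not_congr add_mem_sh'

theorem mem_innerBdry {A : Finset Site} {y : Site} :
    y ∈ innerBdry A ↔ y ∈ A ∧ ∃ d ∈ dirs, y + d ∉ A := by
  unfold innerBdry
  rw [Finset.mem_filter]

theorem innerBdry_sh {t y : Site} {A : Finset Site} :
    y + t ∈ innerBdry (sh t A) ↔ y ∈ innerBdry A := by
  simp only [mem_innerBdry, add_mem_sh, add_mem_sh']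

theorem sh_subset {t : Site} {A B : Finset Site} : sh t A ⊆ sh t B ↔ A ⊆ B := by
  unfold sh
  exact Finset.map_subset_map

theorem sh_disjoint {t : Site} {A B : Finset Site} : Disjoint (sh t A) (sh t B) ↔ Disjoint A B := by
  unfold sh
  exact Finset.disjoint_map _

theorem forall_sh {t : Site} {p : Site → Prop} : (∀ x, p x) ↔ ∀ x, p (x + t) :=
  ⟨fun h x => h _, fun h x => by simpa using h (x - t)⟩

theorem exists_sh {t : Site} {p : Site → Prop} : (∃ x, p x) ↔ ∃ x, p (x + t) :=
  ⟨fun ⟨x, h⟩ => ⟨x - t, by simpa using h⟩, fun ⟨x, h⟩ => ⟨_, h⟩⟩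

theorem sh_neg (t : Site) (A : Finset Site) : sh (-t) (sh t A) = A := by
  ext y; simp [mem_sh]

theorem sh_neg' (t : Site) (A : Finset Site) : sh t (sh (-t) A) = A := by
  ext y; simp [mem_sh]

theorem Zsos_sh (β lam : ℝ) (s : BSign) (h : ℤ) (t : Site) (V : Finset Site) :
    Zsos β lam (constSign s) h (sh t V) = Zsos β lam (constSign s) h V := by
  unfold Zsos
  rw [← Equiv.tsum_eq ((Equiv.addRight t).arrowCongr (Equiv.refl ℤ))]
  apply tsum_congr
  intro ψ
  set φ := ((Equiv.addRight t).arrowCongr (Equiv.refl ℤ)) ψ with hφ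
  have hv : ∀ y, φ (y + t) = ψ y := by
    intro y
    simp [hφ, Equiv.arrowCongr]
  have hv' : ∀ y d, φ (y + t + d) = ψ (y + d) := by
    intro y d
    rw [add_right_comm]; exact hv _
  have h1 : φ ∈ signedConfigs (sh t V) (constSign s) h ↔ ψ ∈ signedConfigs V (constSign s) h := by
    unfold signedConfigs
    simp only [Set.mem_ofPred_eq]
    rw [forall_sh (t := t) (p := fun x => x ∉ sh t V → φ x = h),
      forall_sh (t := t) (p := fun x => x ∈ sh t V → 0 ≤ φ x),
      forall_sh (t := t) (p := fun x => x ∈ innerBdry (sh t V) → _)]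
    simp only [add_mem_sh, hv, innerBdry_sh, constSign]
  have h2 : sosWt β lam (sh t V) φ = sosWt β lam V ψ := by
    unfold sosWt sosEnergy sosField
    rw [sum_sh, sum_sh]
    simp only [hv, hv', add_mem_sh']
  by_cases hm : ψ ∈ signedConfigs V (constSign s) h
  · rw [Set.indicator_of_mem hm, Set.indicator_of_mem (h1.2 hm), h2]
  · rw [Set.indicator_of_notMem hm, Set.indicator_of_notMem (fun h' => hm (h1.1 h'))]

theorem connectedIn_sh' (t : Site) (S S' : Set Site) (hS : ∀ y, y + t ∈ S' ↔ y ∈ S)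
    (h : connectedIn S) : connectedIn S' := by
  intro x hx y hy
  have hx' : x - t ∈ S := (hS _).1 (by simpa using hx)
  have hy' : y - t ∈ S := (hS _).1 (by simpa using hy)
  have := Relation.ReflTransGen.lift (r := fun a b => adjS a b ∧ a ∈ S ∧ b ∈ S)
    (p := fun a b => adjS a b ∧ a ∈ S' ∧ b ∈ S') (fun a => a + t) (by
      rintro a b ⟨h1, h2, h3⟩
      refine ⟨?_, (hS _).2 h2, (hS _).2 h3⟩
      unfold adjS at *
      simpa using h1) _ _ (h _ hx' _ hy')
  simpa [Function.onFun] using this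

theorem connectedIn_sh (t : Site) (S S' : Set Site) (hS : ∀ y, y + t ∈ S' ↔ y ∈ S) :
    connectedIn S' ↔ connectedIn S := by
  refine ⟨connectedIn_sh' (-t) S' S ?_, connectedIn_sh' t S S' hS⟩
  intro y
  rw [← hS]
  simp

/-- translation of contours. -/
noncomputable def csh (t : Site) : Contour ≃ Contour where
  toFun γ := ⟨sh t γ.int, γ.up⟩
  invFun γ := ⟨sh (-t) γ.int, γ.up⟩
  left_inv γ := by simp [sh_neg]
  right_inv γ := by simp [sh_neg']

theorem csh_int (t : Site) (γ : Contour) : (csh t γ).int = sh t γ.int := rfl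
theorem csh_up (t : Site) (γ : Contour) : (csh t γ).up = γ.up := rfl

theorem csh_len (t : Site) (γ : Contour) : (csh t γ).len = γ.len := edgeBdryCard_sh t γ.int

theorem csh_valid (t : Site) (γ : Contour) : (csh t γ).valid ↔ γ.valid := by
  unfold Contour.valid
  rw [csh_int]
  refine and_congr ?_ (and_congr ?_ ?_)
  · unfold sh; exact Finset.map_nonempty
  · apply connectedIn_sh t
    intro y
    simpa using add_mem_sh
  · apply connectedIn_sh t
    intro y
    simpa using not_congr add_mem_sh

theorem shareEdge_sh (t : Site) (A B : Finset Site) : shareEdge (sh t A) (sh t B) ↔ shareEdge A B := by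
  unfold shareEdge
  rw [exists_sh (t := t)]
  simp only [add_mem_sh, add_mem_sh']

theorem CC_sh (t : Site) (γ γ' : Contour) : CC (csh t γ) (csh t γ') ↔ CC γ γ' := by
  unfold CC compatPair
  simp only [csh_int, csh_up, sh_subset, sh_disjoint, shareEdge_sh, EmbeddingLike.apply_eq_iff_eq]

theorem Wtr_sh (β lam : ℝ) (h : ℤ) (t : Site) (γ : Contour) :
    Wtr β lam h (csh t γ) = Wtr β lam h γ := by
  unfold Wtr Wrn
  simp only [csh_len, csh_int, csh_up, Zsos_sh]

theorem polyZ_equiv {P : Type*} (σ : P ≃ P) (C : P → P → Prop) (W : P → ℝ) (A B : Finset P)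
    (hC : ∀ γ γ', C (σ γ) (σ γ') ↔ C γ γ') (hW : ∀ γ, W (σ γ) = W γ)
    (hAB : ∀ γ, σ γ ∈ B ↔ γ ∈ A) : polyZ C W B = polyZ C W A := by
  unfold polyZ
  have hb : Function.Bijective (Multiset.map σ) := by
    refine ⟨Multiset.map_injective σ.injective, fun Γ => ⟨Γ.map σ.symm, ?_⟩⟩
    rw [Multiset.map_map]
    simp
  rw [← Equiv.tsum_eq (Equiv.ofBijective _ hb)]
  apply tsum_congr
  intro Γ
  simp only [Equiv.ofBijective_apply]
  have key : ((∀ γ ∈ Γ.map σ, γ ∈ B) ∧ ∀ γ ∈ Γ.map σ, ∀ γ' ∈ Γ.map σ, C γ γ') ↔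
      ((∀ γ ∈ Γ, γ ∈ A) ∧ ∀ γ ∈ Γ, ∀ γ' ∈ Γ, C γ γ') := by
    simp [hAB, hC]
  by_cases hm : (∀ γ ∈ Γ, γ ∈ A) ∧ ∀ γ ∈ Γ, ∀ γ' ∈ Γ, C γ γ'
  · have hm' := key.2 hm
    rw [polyF_of _ _ _ _ hm.1 hm.2, polyF_of _ _ _ _ hm'.1 hm'.2, Multiset.map_map]
    congr 2
    funext γ
    exact hW γ
  · have z1 : polyF C W A Γ = 0 := by
      by_contra hne
      exact hm (polyF_ne _ _ _ _ hne)
    have z2 : polyF C W B (Γ.map σ) = 0 := by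
      by_contra hne
      exact hm (key.1 (polyF_ne _ _ _ _ hne))
    rw [z1, z2]

theorem fam_sh (s : BSign) (h : ℤ) (t : Site) (U V : Finset Site) (γ : Contour) :
    csh t γ ∈ fam (constSign s) h (sh t U) (sh t V) ↔ γ ∈ fam (constSign s) h U V := by
  rw [mem_fam, mem_fam]
  unfold allow
  rw [csh_valid, forall_sh (t := t)]
  simp only [csh_int, csh_up, sh_subset, innerBdry_sh, add_mem_sh, constSign]

theorem polyZ_sh (β lam : ℝ) (s : BSign) (h : ℤ) (t : Site) (U V : Finset Site) :
    polyZ CC (Wtr β lam h) (fam (constSign s) h (sh t U) (sh t V)) =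
      polyZ CC (Wtr β lam h) (fam (constSign s) h U V) :=
  polyZ_equiv (csh t) CC _ _ _ (CC_sh t) (Wtr_sh β lam h t) (fam_sh s h t U V)

theorem locT_sh (β lam : ℝ) (s : BSign) (h : ℤ) (t x : Site) (U : Finset Site) :
    locT β lam (constSign s) h (sh t U) (x + t) = locT β lam (constSign s) h U x := by
  unfold locT
  have e1 : ((sh t U).filter fun y => toLex y ≤ toLex (x + t)) =
      sh t (U.filter fun y => toLex y ≤ toLex x) := by
    ext y
    simp only [Finset.mem_filter, mem_sh, Prod.Lex.toLex_le_toLex, Prod.fst_sub, Prod.snd_sub,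
      Prod.fst_add, Prod.snd_add]
    apply and_congr_right
    intro _
    omega
  have e2 : ((sh t U).filter fun y => toLex y < toLex (x + t)) =
      sh t (U.filter fun y => toLex y < toLex x) := by
    ext y
    simp only [Finset.mem_filter, mem_sh, Prod.Lex.toLex_lt_toLex, Prod.fst_sub, Prod.snd_sub,
      Prod.fst_add, Prod.snd_add]
    apply and_congr_right
    intro _
    omega
  rw [e1, e2, polyZ_sh, polyZ_sh]
end PartE

section PartF
attribute [local instance] Classical.propDecidable

theorem mem_box {n : ℕ} {y : Site} : y ∈ box n ↔
    (-((n : ℤ) / 2) ≤ y.1 ∧ y.1 ≤ (n : ℤ) / 2) ∧ (-((n : ℤ) / 2) ≤ y.2 ∧ y.2 ≤ (n : ℤ) / 2) := by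
  unfold box
  simp only [Finset.mem_product, Finset.mem_Icc]

theorem box_ball (n R : ℕ) (hn : 2 * R ≤ n) (y : Site) (hy : d1 0 y < R) :
    y ∈ box n ∧ y ∉ innerBdry (box n) := by
  have hb : |y.1| + |y.2| < R := by
    unfold d1 at hy
    simpa using hy
  have h1 := abs_lt.1 (lt_of_le_of_lt (le_add_of_nonneg_right (abs_nonneg y.2)) hb)
  have h2 := abs_lt.1 (lt_of_le_of_lt (le_add_of_nonneg_left (abs_nonneg y.1)) hb)
  refine ⟨mem_box.2 (by omega), ?_⟩
  rw [mem_innerBdry]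
  rintro ⟨_, d, hd, hnd⟩
  apply hnd
  rw [mem_box, Prod.fst_add, Prod.snd_add]
  rw [mem_dirs] at hd
  rcases hd with h | h | h | h <;> subst h <;> simp only [] <;> omega

theorem sh_box_ball (x : Site) (n R : ℕ) (hn : 2 * R ≤ n) (y : Site) (hy : d1 x y < R) :
    y ∈ sh x (box n) ∧ y ∉ innerBdry (sh x (box n)) := by
  have h := box_ball n R hn (y - x) (by
    unfold d1 at *
    have e1 : (0 : Site).1 - (y - x).1 = x.1 - y.1 := by simp
    have e2 : (0 : Site).2 - (y - x).2 = x.2 - y.2 := by simp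
    rw [e1, e2]; exact hy)
  have e : y = (y - x) + x := by simp
  rw [e, add_mem_sh, innerBdry_sh]
  exact h

theorem loc_limit (β lam : ℝ) (hβ : 100 < β) (h : ℤ) : ∃ r : ℝ,
    ∀ (η : Site → BSign) (U : Finset Site) (x : Site) (R : ℕ),
      (∀ y, d1 x y < R → y ∈ U ∧ y ∉ innerBdry U) →
      |locT β lam η h U x - r| ≤ 8 * Real.exp (-(β - 15)) * Real.exp (-R) := by
  set a : ℕ → ℝ := fun n => locT β lam (constSign .free) h (box n) 0 with ha
  have hc : CauchySeq a := by
    apply cauchySeq_of_le_tendsto_0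
      (fun N => 8 * Real.exp (-(β - 15)) * Real.exp (-((N / 2 : ℕ) : ℝ)))
    · intro n m N hn hm
      rw [Real.dist_eq]
      exact locT_compare β lam hβ h _ _ _ _ 0 (N / 2)
        (fun y hy => box_ball n (N / 2) (by omega) y hy)
        (fun y hy => box_ball m (N / 2) (by omega) y hy)
    · have t1 : Tendsto (fun N : ℕ => ((N / 2 : ℕ) : ℝ)) atTop atTop :=
        tendsto_natCast_atTop_atTop.comp (Nat.tendsto_div_const_atTop (by norm_num))
      have t2 := (Real.tendsto_exp_neg_atTop_nhds_zero.comp t1).const_mul (8 * Real.exp (-(β - 15)))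
      rw [mul_zero] at t2
      exact t2
  obtain ⟨r, hr⟩ := cauchySeq_tendsto_of_complete hc
  refine ⟨r, fun η U x R hU => ?_⟩
  have ht : Tendsto (fun n => |locT β lam η h U x - a n|) atTop (nhds |locT β lam η h U x - r|) :=
    (tendsto_const_nhds.sub hr).abs
  apply le_of_tendsto ht
  filter_upwards [eventually_ge_atTop (2 * R)] with n hn
  have e : a n = locT β lam (constSign .free) h (sh x (box n)) x := by
    have := locT_sh β lam .free h x 0 (box n)
    rw [zero_add] at this
    rw [this]
  rw [e]
  exact locT_compare β lam hβ h _ _ _ _ x R hU (fun y hy => sh_box_ball x n R hn y hy)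

theorem step_toward (x y : Site) (n : ℕ) (h : d1 x y = n + 1) :
    ∃ y' d, d ∈ dirs ∧ y = y' + d ∧ d1 x y' = n := by
  obtain ⟨x1, x2⟩ := x
  obtain ⟨y1, y2⟩ := y
  unfold d1 at *
  simp only at h
  rcases lt_trichotomy x1 y1 with h1 | h1 | h1
  · refine ⟨(y1 - 1, y2), (1, 0), by simp [mem_dirs], by simp, ?_⟩
    simp only
    rw [abs_of_neg (by omega)] at h
    rw [abs_of_nonpos (by omega)]
    omega
  · subst h1
    rcases lt_trichotomy x2 y2 with h2 | h2 | h2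
    · refine ⟨(x1, y2 - 1), (0, 1), by simp [mem_dirs], by simp, ?_⟩
      simp only
      rw [abs_of_neg (a := x2 - y2) (by omega)] at h
      rw [abs_of_nonpos (a := x2 - (y2 - 1)) (by omega)]
      omega
    · subst h2
      simp at h
      omega
    · refine ⟨(x1, y2 + 1), (0, -1), by simp [mem_dirs], by simp, ?_⟩
      simp only
      rw [abs_of_pos (a := x2 - y2) (by omega)] at h
      rw [abs_of_nonneg (a := x2 - (y2 + 1)) (by omega)]
      omega
  · refine ⟨(y1 + 1, y2), (-1, 0), by simp [mem_dirs], by simp, ?_⟩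
    simp only
    rw [abs_of_pos (a := x1 - y1) (by omega)] at h
    rw [abs_of_nonneg (a := x1 - (y1 + 1)) (by omega)]
    omega

theorem innerBdry_nonempty (U : Finset Site) (hU : U.Nonempty) : (innerBdry U).Nonempty := by
  obtain ⟨v, hv, hmax⟩ := U.exists_max_image (fun y => y.1) hU
  refine ⟨v, mem_innerBdry.2 ⟨hv, (1, 0), by simp [mem_dirs], fun hc => ?_⟩⟩
  have := hmax _ hc
  simp at this

theorem near_bdry (U : Finset Site) (x : Site) (hx : x ∈ U) :
    ∃ v ∈ innerBdry U, ∀ y, d1 x y < d1 x v → y ∈ U ∧ y ∉ innerBdry U := by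
  obtain ⟨v, hv, hmin⟩ := (innerBdry U).exists_min_image (fun y => d1 x y) (innerBdry_nonempty U ⟨x, hx⟩)
  have hnot : ∀ y, d1 x y < d1 x v → y ∉ innerBdry U := by
    intro y hy hc
    exact absurd (hmin y hc) (not_le.2 hy)
  have key : ∀ n : ℕ, ∀ y, d1 x y = n → d1 x y < d1 x v → y ∈ U := by
    intro n
    induction n with
    | zero =>
      intro y hy _
      have : x = y := by
        unfold d1 at hy
        have h1 := abs_nonneg (x.1 - y.1)
        have h2 := abs_nonneg (x.2 - y.2)
        have h3 : |x.1 - y.1| = 0 := by push_cast at hy; omega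
        have h4 : |x.2 - y.2| = 0 := by push_cast at hy; omega
        rw [abs_eq_zero, sub_eq_zero] at h3 h4
        exact Prod.ext h3 h4
      exact this ▸ hx
    | succ n ih =>
      intro y hy hlt
      obtain ⟨y', d, hd, rfl, hy'⟩ := step_toward x y n (by exact_mod_cast hy)
      have hlt' : d1 x y' < d1 x v := by rw [hy'] ; rw [hy] at hlt; push_cast at hlt; omega
      have hU' := ih y' hy' hlt'
      by_contra hc
      exact hnot y' hlt' (mem_innerBdry.2 ⟨hU', d, hd, hc⟩)
  refine ⟨v, hv, fun y hy => ⟨?_, hnot y hy⟩⟩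
  exact key (d1 x y).toNat y (Int.toNat_of_nonneg (d1_nonneg x y)).symm hy

theorem half_sum (s : Finset ℤ) (f : ℤ → ℕ) (hf : Set.InjOn f s) :
    ∑ k ∈ s, ((1 : ℝ) / 2) ^ f k ≤ 2 := by
  rw [← Finset.sum_image (f := fun n => ((1 : ℝ) / 2) ^ n) hf]
  refine (summable_geometric_two.sum_le_tsum _ (fun i _ => by positivity)).trans ?_
  exact tsum_geometric_two.le

theorem exp_le_half (n : ℕ) (z : ℝ) (hz : z = n) : Real.exp (-z) ≤ ((1 : ℝ) / 2) ^ n := by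
  subst hz
  have h1 := Real.add_one_le_exp 1
  rw [Real.exp_neg, ← mul_one (n : ℝ), Real.exp_nat_mul, one_div, inv_pow]
  apply inv_anti₀ (by positivity)
  gcongr
  linarith

theorem expZ (s : Finset ℤ) (c : ℤ) : ∑ k ∈ s, Real.exp (-(|k - c| : ℤ)) ≤ 4 := by
  rw [← Finset.sum_filter_add_sum_filter_not s (fun k => c ≤ k)]
  have h1 : ∑ k ∈ s.filter (fun k => c ≤ k), Real.exp (-(|k - c| : ℤ)) ≤ 2 := by
    refine le_trans (Finset.sum_le_sum fun k hk => exp_le_half (k - c).toNat _ ?_)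
      (half_sum _ (fun k => (k - c).toNat) ?_)
    · have := (Finset.mem_filter.1 hk).2
      have e : |k - c| = ((k - c).toNat : ℤ) := by rw [abs_of_nonneg (by omega)]; omega
      rw [e]; exact Int.cast_natCast _
    · intro k hk k' hk' he
      have := (Finset.mem_filter.1 hk).2
      have := (Finset.mem_filter.1 hk').2
      simp only at he
      omega
  have h2 : ∑ k ∈ s.filter (fun k => ¬ c ≤ k), Real.exp (-(|k - c| : ℤ)) ≤ 2 := by
    refine le_trans (Finset.sum_le_sum fun k hk => exp_le_half (c - k).toNat _ ?_)
      (half_sum _ (fun k => (c - k).toNat) ?_)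
    · have := (Finset.mem_filter.1 hk).2
      have e : |k - c| = ((c - k).toNat : ℤ) := by rw [abs_of_nonpos (by omega)]; omega
      rw [e]; exact Int.cast_natCast _
    · intro k hk k' hk' he
      have := (Finset.mem_filter.1 hk).2
      have := (Finset.mem_filter.1 hk').2
      simp only at he
      omega
  linarith

theorem exp2_sum (U : Finset Site) (v : Site) : ∑ x ∈ U, Real.exp (-(d1 x v : ℝ)) ≤ 16 := by
  have hs : U ⊆ U.image Prod.fst ×ˢ U.image Prod.snd := Finset.subset_product
  refine (Finset.sum_le_sum_of_subset_of_nonneg hs fun _ _ _ => (Real.exp_pos _).le).trans ?_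
  rw [Finset.sum_product]
  have e : ∀ a b : ℤ, Real.exp (-(d1 (a, b) v : ℝ)) =
      Real.exp (-(|a - v.1| : ℤ)) * Real.exp (-(|b - v.2| : ℤ)) := by
    intro a b
    rw [← Real.exp_add]
    unfold d1
    push_cast
    ring_nf
  simp only [e]
  rw [← Finset.sum_mul_sum]
  have h1 := expZ (U.image Prod.fst) v.1
  have h2 := expZ (U.image Prod.snd) v.2
  calc _ ≤ (4 : ℝ) * 4 := by
        apply mul_le_mul h1 h2 _ (by norm_num)
        exact Finset.sum_nonneg fun _ _ => (Real.exp_pos _).le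
    _ = 16 := by norm_num

theorem innerBdry_card (U : Finset Site) : (innerBdry U).card ≤ edgeBdryCard U := by
  rw [← card_bd]
  refine (Finset.card_le_card (t := (bd U).image Prod.fst) ?_).trans Finset.card_image_le
  intro v hv
  obtain ⟨h1, d, h2, h3⟩ := mem_innerBdry.1 hv
  exact Finset.mem_image.2 ⟨(v, d), mem_bd.2 ⟨h1, h2, h3⟩, rfl⟩

theorem const_bound (β : ℝ) (hβ : 100 < β) : 128 * Real.exp (-(β - 15)) ≤ Real.exp (-β / 2) := by
  have h1 : (128 : ℝ) ≤ Real.exp 7 := by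
    have h2 := Real.add_one_le_exp 1
    have : (128 : ℝ) = 2 ^ 7 := by norm_num
    rw [this, show (7 : ℝ) = (7 : ℕ) * 1 by norm_num, Real.exp_nat_mul]
    gcongr
    linarith
  calc _ ≤ Real.exp 7 * Real.exp (-(β - 15)) := by gcongr
    _ = Real.exp (7 + -(β - 15)) := (Real.exp_add _ _).symm
    _ ≤ _ := Real.exp_le_exp.2 (by linarith)

theorem sum_bound (β lam : ℝ) (hβ : 100 < β) (h : ℤ) (r : ℝ)
    (hr : ∀ (η : Site → BSign) (U : Finset Site) (x : Site) (R : ℕ),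
      (∀ y, d1 x y < R → y ∈ U ∧ y ∉ innerBdry U) →
      |locT β lam η h U x - r| ≤ 8 * Real.exp (-(β - 15)) * Real.exp (-R))
    (η : Site → BSign) (U : Finset Site) :
    |∑ x ∈ U, (locT β lam η h U x - r)| ≤ Real.exp (-β / 2) * (edgeBdryCard U : ℝ) := by
  set K := 8 * Real.exp (-(β - 15)) with hK
  have hKp : 0 < K := by positivity
  have hx : ∀ x ∈ U, |locT β lam η h U x - r| ≤ ∑ v ∈ innerBdry U, K * Real.exp (-(d1 x v : ℝ)) := by
    intro x hx
    obtain ⟨v, hv, hd⟩ := near_bdry U x hx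
    have e : ((d1 x v).toNat : ℤ) = d1 x v := Int.toNat_of_nonneg (d1_nonneg x v)
    have := hr η U x (d1 x v).toNat (fun y hy => hd y (by rw [e] at hy; exact hy))
    have e' : (((d1 x v).toNat : ℕ) : ℝ) = (d1 x v : ℝ) := by exact_mod_cast e
    rw [e'] at this
    exact this.trans (Finset.single_le_sum (f := fun v => K * Real.exp (-(d1 x v : ℝ)))
      (fun _ _ => by positivity) hv)
  refine (Finset.abs_sum_le_sum_abs _ _).trans ((Finset.sum_le_sum hx).trans ?_)
  rw [Finset.sum_comm]
  have hv : ∀ v ∈ innerBdry U, ∑ x ∈ U, K * Real.exp (-(d1 x v : ℝ)) ≤ K * 16 := by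
    intro v _
    rw [← Finset.mul_sum]
    exact mul_le_mul_of_nonneg_left (exp2_sum U v) hKp.le
  refine (Finset.sum_le_sum hv).trans ?_
  rw [Finset.sum_const, nsmul_eq_mul]
  have hc : ((innerBdry U).card : ℝ) ≤ edgeBdryCard U := by exact_mod_cast innerBdry_card U
  calc ((innerBdry U).card : ℝ) * (K * 16) ≤ edgeBdryCard U * (K * 16) := by gcongr
    _ = edgeBdryCard U * (128 * Real.exp (-(β - 15))) := by rw [hK]; ring
    _ ≤ edgeBdryCard U * Real.exp (-β / 2) := by
        apply mul_le_mul_of_nonneg_left (const_bound β hβ); positivity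
    _ = _ := mul_comm _ _

theorem log_Ztr (β lam : ℝ) (hβ : 100 < β) (η : Site → BSign) (h : ℤ) (U : Finset Site) :
    Real.log (Ztr β lam η h U) = -lam * h * U.card + ∑ x ∈ U, locT β lam η h U x := by
  have hp : 0 < polyZ CC (Wtr β lam h) (fam η h U U) :=
    polyZ_pos CC _ CC_refl _ fun γ hγ => ⟨Wtr_nonneg _ _ _ _, by
      linarith [Wtr_half β lam hβ h γ (mem_fam.1 hγ).2.1]⟩
  rw [Ztr_eq, Real.log_mul (Real.exp_pos _).ne' hp.ne', Real.log_exp, logZ_sum]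

theorem card_box (n : ℕ) : (box n).card = (2 * (n / 2) + 1) ^ 2 := by
  unfold box
  rw [Finset.card_product, Int.card_Icc]
  have : ((n : ℤ) / 2 + 1 - -((n : ℤ) / 2)).toNat = 2 * (n / 2) + 1 := by omega
  rw [this]; ring

theorem edge_box (n : ℕ) : edgeBdryCard (box n) ≤ 4 * (2 * (n / 2) + 1) := by
  rw [← card_bd]
  set m : ℤ := (n : ℤ) / 2 with hm
  have hsub : bd (box n) ⊆ (Finset.Icc (-m) m ×ˢ dirs).image
      (fun p => ((if p.2.1 = 0 then (p.1, p.2.2 * m) else (p.2.1 * m, p.1), p.2) : Site × Site)) := by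
    rintro ⟨⟨a, b⟩, d⟩ hp
    obtain ⟨h1, h2, h3⟩ := mem_bd.1 hp
    simp only [mem_box, ← hm] at h1 h3
    rw [Finset.mem_image]
    simp only at h2
    rw [mem_dirs] at h2
    rcases h2 with h | h | h | h <;> subst h
    · refine ⟨(b, (1, 0)), ?_, ?_⟩
      · simp [mem_dirs]; omega
      · simp at h3 ⊢; omega
    · refine ⟨(b, (-1, 0)), ?_, ?_⟩
      · simp [mem_dirs]; omega
      · simp at h3 ⊢; omega
    · refine ⟨(a, (0, 1)), ?_, ?_⟩
      · simp [mem_dirs]; omega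
      · simp at h3 ⊢; omega
    · refine ⟨(a, (0, -1)), ?_, ?_⟩
      · simp [mem_dirs]; omega
      · simp at h3 ⊢; omega
  refine (Finset.card_le_card hsub).trans (Finset.card_image_le.trans ?_)
  rw [Finset.card_product, Int.card_Icc]
  have e : (m + 1 - -m).toNat = 2 * (n / 2) + 1 := by omega
  have e2 : dirs.card = 4 := by decide
  rw [e, e2]
  omega

theorem ratio_box (n : ℕ) (hn : 0 < n) :
    (edgeBdryCard (box n) : ℝ) / ((box n).card : ℝ) ≤ 4 / n := by
  have h1 : (edgeBdryCard (box n) : ℝ) ≤ 4 * (2 * (n / 2 : ℕ) + 1) := by exact_mod_cast edge_box n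
  rw [card_box]
  have h2 : (n : ℝ) ≤ 2 * (n / 2 : ℕ) + 1 := by
    have : n ≤ 2 * (n / 2) + 1 := by omega
    exact_mod_cast this
  have hn' : (0 : ℝ) < n := by exact_mod_cast hn
  push_cast
  rw [div_le_div_iff₀ (by positivity) hn']
  have h0 : (0 : ℝ) < 2 * (n / 2 : ℕ) + 1 := by positivity
  calc _ ≤ (4 * (2 * ((n / 2 : ℕ) : ℝ) + 1)) * (2 * ((n / 2 : ℕ) : ℝ) + 1) := by
        apply mul_le_mul h1 h2 hn'.le (by positivity)
    _ = _ := by ring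

end PartF

theorem statement12 :
    ∃ β₀ : ℝ, ∀ β : ℝ, β₀ < β → ∀ lam : ℝ, 0 < lam → lam ≤ 1 →
      ∃ ftr : ℕ → ℝ,
        (∀ h : ℕ, ∀ η : Site → BSign,
          Tendsto (fun n => Real.log (Ztr β lam η (h : ℤ) (box n)) / ((box n).card : ℝ))
            atTop (nhds (ftr h))) ∧
        ∀ U : Finset Site, ∀ h : ℕ, ∀ η : Site → BSign,
          |Real.log (Ztr β lam η (h : ℤ) U) - (U.card : ℝ) * ftr h| ≤
            Real.exp (-β / 2) * (edgeBdryCard U : ℝ) := by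
  refine ⟨100, fun β hβ lam hl hl1 => ?_⟩
  choose r hr using fun h : ℕ => loc_limit β lam hβ (h : ℤ)
  have main : ∀ U : Finset Site, ∀ h : ℕ, ∀ η : Site → BSign,
      |Real.log (Ztr β lam η (h : ℤ) U) - (U.card : ℝ) * (-lam * h + r h)| ≤
        Real.exp (-β / 2) * (edgeBdryCard U : ℝ) := by
    intro U h η
    have hs := sum_bound β lam hβ h (r h) (hr h) η U
    rw [Finset.sum_sub_distrib, Finset.sum_const, nsmul_eq_mul] at hs
    rw [log_Ztr β lam hβ]
    refine le_trans (le_of_eq ?_) hs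
    congr 1
    push_cast
    ring
  refine ⟨fun h => -lam * h + r h, fun h η => ?_, main⟩
  rw [tendsto_iff_dist_tendsto_zero]
  have t0 : Tendsto (fun n : ℕ => Real.exp (-β / 2) * (4 / (n : ℝ))) atTop (nhds 0) := by
    have := (tendsto_const_div_atTop_nhds_zero_nat (4 : ℝ)).const_mul (Real.exp (-β / 2))
    rwa [mul_zero] at this
  refine squeeze_zero' (Eventually.of_forall fun _ => dist_nonneg) ?_ t0
  filter_upwards [eventually_gt_atTop 0] with n hn
  have hcp : (0 : ℝ) < (box n).card := by
    rw [card_box]; positivity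
  have hm := main (box n) h η
  rw [Real.dist_eq]
  have e : Real.log (Ztr β lam η (h : ℤ) (box n)) / ((box n).card : ℝ) - (-lam * h + r h) =
      (Real.log (Ztr β lam η (h : ℤ) (box n)) - ((box n).card : ℝ) * (-lam * h + r h)) /
        (box n).card := by
    field_simp
  rw [e, abs_div, abs_of_pos hcp, div_le_iff₀ hcp]
  have hrb := ratio_box n hn
  rw [div_le_iff₀ hcp] at hrb
  refine hm.trans ?_
  rw [mul_assoc]
  exact mul_le_mul_of_nonneg_left hrb (Real.exp_pos _).le
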